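/- arXiv:math/0208178 — 5 statements merged into one kernel-verified Lean document; each statement's English description precedes it below -/
import Mathlib

section
/- Theorem 1 (combinatorial form, as reduced in the paper). Let a, b ∈ ℤⁿ be such that P(a) is ample and P(b) is globally generated. Then (P(a) ∩ ℤ²) + (P(b) ∩ ℤ²) = (P(a) + P(b)) ∩ ℤ², where on the left + denotes the set of all sums of a lattice point of P(a) and a lattice point of P(b), and P(a) + P(b) is the Minkowski sum. Equivalently, every lattice point of P(a) + P(b) is the sum of a lattice point of P(a) and a lattice point of P(b). (This is equivalent to: for a smooth projective toric surface X with an ample line bundle L and a globally generated line bundle M, the multiplication map H⁰(X,L) ⊗ H⁰(X,M) → H⁰(X, L⊗M) is surjective.) -/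
open scoped Pointwise

/-- The real vector in `ℝ²` corresponding to an integer vector. -/
def vecR (m : ℤ × ℤ) : ℝ × ℝ := ((m.1 : ℝ), (m.2 : ℝ))

/-- The standard inner (dot) product on `ℝ²`. -/
def dotR (u w : ℝ × ℝ) : ℝ := u.1 * w.1 + u.2 * w.2

/-- The standard lattice `ℤ²` viewed inside `ℝ²`. -/
def latticeR2 : Set (ℝ × ℝ) := {u | ∃ m : ℤ × ℤ, u = vecR m}

/-- The data of a complete smooth fan in `ℝ²`: `n` primitive integer vectors
`v 0, …, v (n-1)` (indices modulo `n`) such that `det (v i, v (i+1)) = 1` for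
every `i`, and such that the rays through the `v i`, taken in this cyclic
order, wind exactly once counterclockwise around the origin.  The last
condition is expressed by saying that every nonzero vector of `ℝ²` lies in
exactly one of the half-open cones `{s • v i + t • v (i+1) : s ≥ 0, t > 0}`. -/
def IsCompleteSmoothFan (n : ℕ) (v : ZMod n → ℤ × ℤ) : Prop :=
  (∀ i, IsCoprime (v i).1 (v i).2) ∧
  (∀ i, (v i).1 * (v (i + 1)).2 - (v i).2 * (v (i + 1)).1 = 1) ∧
  (∀ u : ℝ × ℝ, u ≠ 0 →
    ∃! i : ZMod n, ∃ s t : ℝ, 0 ≤ s ∧ 0 < t ∧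
      u = s • vecR (v i) + t • vecR (v (i + 1)))

/-- `Pgon n v a = P(a) = {u ∈ ℝ² : ⟨u, v i⟩ ≥ -a i for all i}`. -/
def Pgon (n : ℕ) (v : ZMod n → ℤ × ℤ) (a : ZMod n → ℤ) : Set (ℝ × ℝ) :=
  {u | ∀ i, -(a i : ℝ) ≤ dotR u (vecR (v i))}

/-- `face n v a i = σ_i(a) = P(a) ∩ {u : ⟨u, v i⟩ = -a i}`. -/
def face (n : ℕ) (v : ZMod n → ℤ × ℤ) (a : ZMod n → ℤ) (i : ZMod n) :
    Set (ℝ × ℝ) :=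
  {u ∈ Pgon n v a | dotR u (vecR (v i)) = -(a i : ℝ)}

/-- `P(a)` is ample: each face `σ_i(a)` is one-dimensional, i.e. a
nondegenerate segment (it contains two distinct points). -/
def IsAmplePgon (n : ℕ) (v : ZMod n → ℤ × ℤ) (a : ZMod n → ℤ) : Prop :=
  ∀ i, ∃ x ∈ face n v a i, ∃ y ∈ face n v a i, x ≠ y

/-- `P(a)` is globally generated: `P(a)` is nonempty, the minimum of
`⟨·, v i⟩` over `P(a)` equals `-a i` for every `i` (equivalently each face
`σ_i(a)` is nonempty), and every extreme point of `P(a)` is a lattice point. -/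
def IsGGPgon (n : ℕ) (v : ZMod n → ℤ × ℤ) (a : ZMod n → ℤ) : Prop :=
  (Pgon n v a).Nonempty ∧
  (∀ i, (face n v a i).Nonempty) ∧
  ∀ u ∈ Set.extremePoints ℝ (Pgon n v a), u ∈ latticeR2

/-- twice the signed area -/
def arR (x y z : ℝ × ℝ) : ℝ := (y.1 - x.1) * (z.2 - x.2) - (y.2 - x.2) * (z.1 - x.1)

lemma mem_seg_of {P : Set (ℝ × ℝ)} {x y w : ℝ × ℝ} (h : Disjoint (segment ℝ x y) P) (hw : w ∈ P)
    (s t : ℝ) (hs : 0 ≤ s) (ht : 0 ≤ t) (hst : s + t = 1)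
    (h1 : w.1 = s * x.1 + t * y.1) (h2 : w.2 = s * x.2 + t * y.2) : False := by
  refine Set.disjoint_left.1 h ⟨s, t, hs, ht, hst, ?_⟩ hw
  ext
  · simp [h1]
  · simp [h2]

lemma mem_comb3 {Q : Set (ℝ × ℝ)} (hQ : Convex ℝ Q) {x y z u : ℝ × ℝ} (hx : x ∈ Q) (hy : y ∈ Q)
    (hz : z ∈ Q) (a b c : ℝ) (ha : 0 ≤ a) (hb : 0 ≤ b) (hc : 0 ≤ c) (h : a + b + c = 1)
    (h1 : u.1 = a * x.1 + b * y.1 + c * z.1) (h2 : u.2 = a * x.2 + b * y.2 + c * z.2) : u ∈ Q := by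
  have hu : u = a • x + b • y + c • z := by
    ext
    · simp [h1]
    · simp [h2]
  rw [hu]
  have := hQ.sum_mem (t := (Finset.univ : Finset (Fin 3))) (w := ![a, b, c]) (z := ![x, y, z])
    (by intro i _; fin_cases i <;> simpa) (by simpa [Fin.sum_univ_three] using h)
    (by intro i _; fin_cases i <;> simpa)
  simpa [Fin.sum_univ_three] using this

lemma mem_comb2 {Q : Set (ℝ × ℝ)} (hQ : Convex ℝ Q) {x y u : ℝ × ℝ} (hx : x ∈ Q) (hy : y ∈ Q)
    (a b : ℝ) (ha : 0 ≤ a) (hb : 0 ≤ b) (h : a + b = 1)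
    (h1 : u.1 = a * x.1 + b * y.1) (h2 : u.2 = a * x.2 + b * y.2) : u ∈ Q :=
  mem_comb3 hQ hx hy hy a b 0 ha hb le_rfl (by linarith) (by linarith) (by linarith)

/-- lexicographic maximisation over a convex hull -/
lemma lex_hull {X : Set (ℝ × ℝ)} {q : ℝ × ℝ} (hq : q ∈ convexHull ℝ X)
    (f1 f2 g1 g2 c : ℝ) (hf : ∀ x ∈ X, f1 * x.1 + f2 * x.2 ≤ c) (hfq : f1 * q.1 + f2 * q.2 = c) :
    ∃ x ∈ X, f1 * x.1 + f2 * x.2 = c ∧ g1 * q.1 + g2 * q.2 ≤ g1 * x.1 + g2 * x.2 := by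
  by_contra! hcon
  set γ := g1 * q.1 + g2 * q.2 with hγ
  let K : Set (ℝ × ℝ) := {u | f1 * u.1 + f2 * u.2 < c ∨
    (f1 * u.1 + f2 * u.2 = c ∧ g1 * u.1 + g2 * u.2 < γ)}
  have hK : Convex ℝ K := by
    rw [convex_iff_forall_pos]
    intro u hu w hw a b ha hb hab
    have hF : f1 * (a • u + b • w).1 + f2 * (a • u + b • w).2
        = a * (f1 * u.1 + f2 * u.2) + b * (f1 * w.1 + f2 * w.2) := by simp; ring
    have hG : g1 * (a • u + b • w).1 + g2 * (a • u + b • w).2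
        = a * (g1 * u.1 + g2 * u.2) + b * (g1 * w.1 + g2 * w.2) := by simp; ring
    have hb' : b = 1 - a := by linarith
    change _ ∨ _
    rw [hF, hG]
    rcases hu with hu | ⟨hu, hu'⟩ <;> rcases hw with hw | ⟨hw, hw'⟩
    · left; have k1 := mul_lt_mul_of_pos_left hu ha
      have k2 := mul_lt_mul_of_pos_left hw hb
      have k3 : a * c + b * c = c := by rw [← add_mul, hab, one_mul]
      linarith
    · left; rw [hw]; have k1 := mul_lt_mul_of_pos_left hu ha
      have k3 : a * c + b * c = c := by rw [← add_mul, hab, one_mul]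
      linarith
    · left; rw [hu]; have k1 := mul_lt_mul_of_pos_left hw hb
      have k3 : a * c + b * c = c := by rw [← add_mul, hab, one_mul]
      linarith
    · right; rw [hu, hw]; constructor
      · rw [hb']; ring
      · have k1 := mul_lt_mul_of_pos_left hu' ha
        have k2 := mul_lt_mul_of_pos_left hw' hb
        have k3 : a * γ + b * γ = γ := by rw [← add_mul, hab, one_mul]
        linarith
  have hXK : X ⊆ K := by
    intro x hx
    rcases (hf x hx).lt_or_eq with h | h
    · exact Or.inl h
    · exact Or.inr ⟨h, hcon x hx h⟩
  rcases convexHull_min hXK hK hq with h | ⟨_, h⟩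
  · linarith
  · exact lt_irrefl _ h

lemma slide (α β c0 c1 : ℝ) (hα : 0 ≤ α) (hβ : 0 ≤ β) (h : c0 < 0 ∨ c1 < 0) :
    ∃ t : ℝ, 0 ≤ t ∧ t ≤ 1 ∧
      ((α + t * (c0 - α) = 0 ∧ 0 ≤ β + t * (c1 - β)) ∨
       (β + t * (c1 - β) = 0 ∧ 0 ≤ α + t * (c0 - α))) := by
  have key : ∀ a c : ℝ, 0 ≤ a → c < 0 → 0 ≤ a / (a - c) ∧ a / (a - c) ≤ 1 ∧
      a + a / (a - c) * (c - a) = 0 := by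
    intro a c ha hc
    have : 0 < a - c := by linarith
    refine ⟨by positivity, by rw [div_le_one this]; linarith, ?_⟩
    field_simp; ring
  have aux : ∀ a c t s : ℝ, 0 ≤ a → c < 0 → a + s * (c - a) = 0 → t ≤ s →
      0 ≤ a + t * (c - a) := by
    intro a c t s ha hc hs hts
    nlinarith
  have aux2 : ∀ a c t : ℝ, 0 ≤ a → 0 ≤ c → 0 ≤ t → t ≤ 1 → 0 ≤ a + t * (c - a) := by
    intro a c t ha hc ht ht1
    nlinarith [mul_nonneg ht hc, mul_nonneg (sub_nonneg.2 ht1) ha]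
  by_cases h0 : c0 < 0
  · obtain ⟨s0, s1, s2⟩ := key α c0 hα h0
    by_cases h1 : c1 < 0
    · obtain ⟨t0, t1, t2⟩ := key β c1 hβ h1
      rcases le_total (α / (α - c0)) (β / (β - c1)) with hle | hle
      · exact ⟨_, s0, s1, Or.inl ⟨s2, aux _ _ _ _ hβ h1 t2 hle⟩⟩
      · exact ⟨_, t0, t1, Or.inr ⟨t2, aux _ _ _ _ hα h0 s2 hle⟩⟩
    · exact ⟨_, s0, s1, Or.inl ⟨s2, aux2 _ _ _ hβ (not_lt.1 h1) s0 s1⟩⟩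
  · have h1 : c1 < 0 := by tauto
    obtain ⟨t0, t1, t2⟩ := key β c1 hβ h1
    exact ⟨_, t0, t1, Or.inr ⟨t2, aux2 _ _ _ hα (not_lt.1 h0) t0 t1⟩⟩

/-- degenerate case of the triangle lemma -/
lemma tri_deg {P : Set (ℝ × ℝ)} {x y z p : ℝ × ℝ} (hxz : Disjoint (segment ℝ x z) P)
    (hzy : Disjoint (segment ℝ z y) P) (α β γ : ℝ) (hα : 0 ≤ α) (hβ : 0 ≤ β) (hγ : 0 ≤ γ)
    (hs : α + β + γ = 1) (h1 : p.1 = α * x.1 + β * y.1 + γ * z.1)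
    (h2 : p.2 = α * x.2 + β * y.2 + γ * z.2) (hp : p ∈ P)
    (m0 m1 m2 : ℝ) (hm : m0 + m1 + m2 = 0) (hm2 : 0 ≤ m2) (hneg : m0 < 0 ∨ m1 < 0)
    (e1 : m0 * x.1 + m1 * y.1 + m2 * z.1 = 0) (e2 : m0 * x.2 + m1 * y.2 + m2 * z.2 = 0) :
    False := by
  obtain ⟨M, hM0, hM⟩ : ∃ M : ℝ, 0 ≤ M ∧ (α + M * m0 < 0 ∨ β + M * m1 < 0) := by
    rcases hneg with h | h
    · refine ⟨(α + 1) / (-m0), by apply div_nonneg <;> linarith, Or.inl ?_⟩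
      have : (α + 1) / (-m0) * m0 = -(α + 1) := by
        have := h.ne; rw [div_neg, neg_mul, div_mul_cancel₀ _ this]
      linarith
    · refine ⟨(β + 1) / (-m1), by apply div_nonneg <;> linarith, Or.inr ?_⟩
      have : (β + 1) / (-m1) * m1 = -(β + 1) := by
        have := h.ne; rw [div_neg, neg_mul, div_mul_cancel₀ _ this]
      linarith
  obtain ⟨t, t0, t1, h⟩ := slide α β (α + M * m0) (β + M * m1) hα hβ hM
  have hz : 0 ≤ γ + t * M * m2 := by positivity
  rcases h with ⟨h, h'⟩ | ⟨h, h'⟩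
  · refine mem_seg_of hzy hp (γ + t * M * m2) (β + t * (β + M * m1 - β)) hz h' ?_ ?_ ?_
    · linear_combination hs - h + t * M * hm
    · linear_combination h1 + x.1 * h - t * M * e1
    · linear_combination h2 + x.2 * h - t * M * e2
  · refine mem_seg_of hxz hp (α + t * (α + M * m0 - α)) (γ + t * M * m2) h' hz ?_ ?_ ?_
    · linear_combination hs - h + t * M * hm
    · linear_combination h1 + y.1 * h - t * M * e1
    · linear_combination h2 + y.2 * h - t * M * e2

lemma tri_deg' {P : Set (ℝ × ℝ)} {x y z p : ℝ × ℝ} (hxz : Disjoint (segment ℝ x z) P)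
    (hzy : Disjoint (segment ℝ z y) P) (α β γ : ℝ) (hα : 0 ≤ α) (hβ : 0 ≤ β) (hγ : 0 ≤ γ)
    (hs : α + β + γ = 1) (h1 : p.1 = α * x.1 + β * y.1 + γ * z.1)
    (h2 : p.2 = α * x.2 + β * y.2 + γ * z.2) (hp : p ∈ P)
    (m0 m1 m2 : ℝ) (hm : m0 + m1 + m2 = 0) (hneg : ¬ (m0 = 0 ∧ m1 = 0))
    (e1 : m0 * x.1 + m1 * y.1 + m2 * z.1 = 0) (e2 : m0 * x.2 + m1 * y.2 + m2 * z.2 = 0) :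
    False := by
  have key : ∀ a b : ℝ, a + b ≤ 0 → ¬ (a = 0 ∧ b = 0) → a < 0 ∨ b < 0 := by
    intro a b hab h
    by_contra! h'
    exact h ⟨by linarith, by linarith⟩
  rcases le_total 0 m2 with h | h
  · exact tri_deg hxz hzy α β γ hα hβ hγ hs h1 h2 hp m0 m1 m2 hm h
      (key _ _ (by linarith) hneg) e1 e2
  · exact tri_deg hxz hzy α β γ hα hβ hγ hs h1 h2 hp (-m0) (-m1) (-m2) (by linarith)
      (by linarith) (key _ _ (by linarith) (by simpa using hneg)) (by linarith) (by linarith)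

lemma tri {P Q : Set (ℝ × ℝ)} (hP : Convex ℝ P) (hPh : P ⊆ convexHull ℝ (P ∩ latticeR2))
    (hQ : Convex ℝ Q) (hno : ∀ u ∈ latticeR2, u ∈ P → u ∉ Q)
    {x y z p : ℝ × ℝ} (hx : x ∈ Q) (hy : y ∈ Q) (hz : z ∈ Q) (hxz : Disjoint (segment ℝ x z) P)
    (hzy : Disjoint (segment ℝ z y) P) (α β γ : ℝ) (hα : 0 ≤ α) (hβ : 0 ≤ β) (hγ : 0 ≤ γ)
    (hs : α + β + γ = 1) (h1 : p.1 = α * x.1 + β * y.1 + γ * z.1)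
    (h2 : p.2 = α * x.2 + β * y.2 + γ * z.2) (hp : p ∈ P) : False := by
  by_cases hd : arR x y z = 0
  · unfold arR at hd
    by_cases c1 : y.1 - z.1 = 0 ∧ z.1 - x.1 = 0
    · by_cases c2 : y.2 - z.2 = 0 ∧ z.2 - x.2 = 0
      · have a1 : y.1 = z.1 := by linarith
        have a2 : x.1 = z.1 := by linarith
        have a3 : y.2 = z.2 := by linarith
        have a4 : x.2 = z.2 := by linarith
        refine mem_seg_of hxz hp 0 1 le_rfl zero_le_one (by norm_num) ?_ ?_
        · rw [h1, a1, a2]; linear_combination z.1 * hs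
        · rw [h2, a3, a4]; linear_combination z.2 * hs
      · exact tri_deg' hxz hzy α β γ hα hβ hγ hs h1 h2 hp (y.2 - z.2) (z.2 - x.2) (x.2 - y.2)
          (by ring) c2 (by linear_combination hd) (by ring)
    · exact tri_deg' hxz hzy α β γ hα hβ hγ hs h1 h2 hp (y.1 - z.1) (z.1 - x.1) (x.1 - y.1)
          (by ring) c1 (by ring) (by linear_combination -hd)
  · set d := arR x y z with hdd
    have hd2 : d = (y.1 - x.1) * (z.2 - x.2) - (y.2 - x.2) * (z.1 - x.1) := rfl
    obtain ⟨C, ⟨hCP, hCL⟩, -, hC⟩ := lex_hull (hPh hp) 0 0 (-(y.2 - x.2) / d) ((y.1 - x.1) / d) 0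
      (by simp) (by simp)
    obtain ⟨c0, hc0⟩ : ∃ c0, c0 = arR C y z / d := ⟨_, rfl⟩
    obtain ⟨c1, hc1⟩ : ∃ c0, c0 = arR x C z / d := ⟨_, rfl⟩
    obtain ⟨c2, hc2⟩ : ∃ c0, c0 = arR x y C / d := ⟨_, rfl⟩
    have hsum : c0 + c1 + c2 = 1 := by
      rw [hc0, hc1, hc2]; field_simp; rw [hd2]; unfold arR; ring
    have hC1 : C.1 = c0 * x.1 + c1 * y.1 + c2 * z.1 := by
      rw [hc0, hc1, hc2]; field_simp; rw [hd2]; unfold arR; ring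
    have hC2 : C.2 = c0 * x.2 + c1 * y.2 + c2 * z.2 := by
      rw [hc0, hc1, hc2]; field_simp; rw [hd2]; unfold arR; ring
    have e1 : arR x y p = d * γ := by
      unfold arR; rw [h1, h2, hd2]
      have : α = 1 - β - γ := by linarith
      rw [this]; ring
    have hγC : γ ≤ c2 := by
      have e2 : γ = arR x y p / d := by rw [e1]; field_simp
      have e3 : ∀ u : ℝ × ℝ, arR x y u / d = (-(y.2 - x.2) / d) * u.1 + ((y.1 - x.1) / d) * u.2
        + (-(y.1-x.1) * x.2 + (y.2 - x.2) * x.1) / d := by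
        intro u; field_simp; unfold arR; ring
      rw [e2, hc2, e3, e3]; linarith
    have hneg : c0 < 0 ∨ c1 < 0 := by
      by_contra! h
      exact hno C hCL hCP (mem_comb3 hQ hx hy hz c0 c1 c2 h.1 h.2 (by linarith) hsum hC1 hC2)
    obtain ⟨t, t0, t1, h⟩ := slide α β c0 c1 hα hβ hneg
    have hw : ((1 - t) * p.1 + t * C.1, (1 - t) * p.2 + t * C.2) ∈ P :=
      mem_comb2 hP hp hCP (1 - t) t (by linarith) t0 (by ring) rfl rfl
    have hz : 0 ≤ γ + t * (c2 - γ) := by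
      have := mul_nonneg t0 (sub_nonneg.2 hγC); linarith
    rcases h with ⟨h, h'⟩ | ⟨h, h'⟩
    · refine mem_seg_of hzy hw _ _ hz h' ?_ ?_ ?_
      · linear_combination (1 - t) * hs + t * hsum - h
      · simp only; rw [h1, hC1]; linear_combination x.1 * h
      · simp only; rw [h2, hC2]; linear_combination x.2 * h
    · refine mem_seg_of hxz hw _ _ h' hz ?_ ?_ ?_
      · linear_combination (1 - t) * hs + t * hsum - h
      · simp only; rw [h1, hC1]; linear_combination y.1 * h
      · simp only; rw [h2, hC2]; linear_combination y.2 * h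

lemma seg_trans {P Q : Set (ℝ × ℝ)} (hP : Convex ℝ P) (hPh : P ⊆ convexHull ℝ (P ∩ latticeR2))
    (hQ : Convex ℝ Q) (hno : ∀ u ∈ latticeR2, u ∈ P → u ∉ Q)
    {x y z : ℝ × ℝ} (hx : x ∈ Q) (hy : y ∈ Q) (hz : z ∈ Q) (hxz : Disjoint (segment ℝ x z) P)
    (hzy : Disjoint (segment ℝ z y) P) : Disjoint (segment ℝ x y) P := by
  rw [Set.disjoint_left]
  rintro p ⟨a, b, ha, hb, hab, rfl⟩ hp
  exact tri hP hPh hQ hno hx hy hz hxz hzy a b 0 ha hb le_rfl (by linarith) (by simp) (by simp) hp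

lemma class_hull {P Q : Set (ℝ × ℝ)} (hP : Convex ℝ P) (hPh : P ⊆ convexHull ℝ (P ∩ latticeR2))
    (hQ : Convex ℝ Q) (hno : ∀ u ∈ latticeR2, u ∈ P → u ∉ Q)
    {X : Set (ℝ × ℝ)} (hX : X ⊆ Q) (hrel : ∀ x ∈ X, ∀ y ∈ X, Disjoint (segment ℝ x y) P) :
    Disjoint (convexHull ℝ X) P := by
  rw [Set.disjoint_left]
  intro p hp hpP
  rw [convexHull_eq_union] at hp
  simp only [Set.mem_iUnion] at hp
  obtain ⟨t, htX, hind, hpt⟩ := hp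
  have hcard : t.card ≤ 3 := by
    have h := hind.card_le_finrank_succ
    have h2 : Module.finrank ℝ (vectorSpan ℝ (Set.range ((↑) : t → ℝ × ℝ))) ≤ 2 := by
      refine (Submodule.finrank_le _).trans ?_
      simp
    simp at h
    omega
  have hne : t.Nonempty := by
    by_contra h
    rw [Finset.not_nonempty_iff_eq_empty] at h
    simp [h] at hpt
  obtain ⟨x, y, z, hxt⟩ : ∃ x y z, t = {x, y, z} := by
    have : 0 < t.card := hne.card_pos
    have h : t.card = 1 ∨ t.card = 2 ∨ t.card = 3 := by omega
    rcases h with h | h | h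
    · obtain ⟨x, rfl⟩ := Finset.card_eq_one.1 h
      exact ⟨x, x, x, by simp⟩
    · obtain ⟨x, y, -, rfl⟩ := Finset.card_eq_two.1 h
      exact ⟨x, y, y, by simp⟩
    · obtain ⟨x, y, z, -, -, -, rfl⟩ := Finset.card_eq_three.1 h
      exact ⟨x, y, z, rfl⟩
  subst hxt
  have hx : x ∈ X := htX (by simp)
  have hy : y ∈ X := htX (by simp)
  have hz : z ∈ X := htX (by simp)
  have : ((({x, y, z} : Finset (ℝ × ℝ)) : Set (ℝ × ℝ))) = insert x {y, z} := by simp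
  rw [this, convexHull_insert (by simp), convexHull_pair, mem_convexJoin] at hpt
  obtain ⟨x', hx', q, ⟨b, c, hb, hc, hbc, rfl⟩, ⟨s, r, hs, hr, hsr, rfl⟩⟩ := hpt
  rw [Set.mem_singleton_iff] at hx'
  subst hx'
  refine tri hP hPh hQ hno (hX hx) (hX hy) (hX hz) (hrel _ hx _ hz) (hrel _ hz _ hy) s (r * b)
    (r * c) hs (by positivity) (by positivity) ?_ ?_ ?_ hpP
  · rw [add_assoc, ← mul_add, hbc]; linarith
  · simp; ring
  · simp; ring

lemma sep_sets {P K : Set (ℝ × ℝ)} (hP : Convex ℝ P) (hPc : IsClosed P) (hK : Convex ℝ K)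
    (hKc : IsCompact K) (hd : Disjoint K P) :
    ∃ m1 m2 u : ℝ, (∀ x ∈ K, m1 * x.1 + m2 * x.2 < u) ∧ ∀ p ∈ P, u < m1 * p.1 + m2 * p.2 := by
  obtain ⟨f, u, w, h1, h2, h3⟩ := geometric_hahn_banach_compact_closed hK hKc hP hPc hd
  have hf : ∀ p : ℝ × ℝ, f p = f (1, 0) * p.1 + f (0, 1) * p.2 := by
    intro p
    have : p = p.1 • ((1, 0) : ℝ × ℝ) + p.2 • ((0, 1) : ℝ × ℝ) := by ext <;> simp
    conv_lhs => rw [this, map_add, map_smul, map_smul]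
    simp [mul_comm]
  refine ⟨f (1, 0), f (0, 1), u, fun x hx => ?_, fun p hp => ?_⟩
  · rw [← hf]; exact h1 x hx
  · rw [← hf]; linarith [h3 p hp]

lemma sep_pt {P : Set (ℝ × ℝ)} (hP : Convex ℝ P) (hPc : IsClosed P) {x : ℝ × ℝ} (hx : x ∉ P) :
    ∃ m1 m2 u : ℝ, (m1 * x.1 + m2 * x.2 < u) ∧ ∀ p ∈ P, u < m1 * p.1 + m2 * p.2 := by
  obtain ⟨m1, m2, u, h, h'⟩ := sep_sets hP hPc (convex_singleton x) isCompact_singleton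
    (Set.disjoint_singleton_left.2 hx)
  exact ⟨m1, m2, u, h x rfl, h'⟩

/-- a functional separating `x` from `P` is positive at `y` if `P` meets `[x,y]` -/
lemma sep_sign {P : Set (ℝ × ℝ)} {x y : ℝ × ℝ} (h : ¬ Disjoint (segment ℝ x y) P)
    {m1 m2 u : ℝ} (hx : m1 * x.1 + m2 * x.2 < u) (hP : ∀ p ∈ P, u < m1 * p.1 + m2 * p.2) :
    u < m1 * y.1 + m2 * y.2 := by
  obtain ⟨p, ⟨s, t, hs, ht, hst, rfl⟩, hp⟩ := Set.not_disjoint_iff.1 h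
  have := hP _ hp
  simp at this
  by_contra! hy
  have k1 := mul_le_mul_of_nonneg_left hx.le hs
  have k2 := mul_le_mul_of_nonneg_left hy ht
  have k3 : s * u + t * u = u := by rw [← add_mul, hst, one_mul]
  linarith

lemma disj_symm {P : Set (ℝ × ℝ)} {x y : ℝ × ℝ} : Disjoint (segment ℝ x y) P ↔
    Disjoint (segment ℝ y x) P := by rw [segment_symm]

lemma far_pt {P : Set (ℝ × ℝ)} (hP : Convex ℝ P) (hPc : IsClosed P)
    (hPh : P ⊆ convexHull ℝ (P ∩ latticeR2)) {x y z : ℝ × ℝ} (lx : x ∈ latticeR2)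
    (ly : y ∈ latticeR2) (lz : z ∈ latticeR2) (hd : arR x y z = 1 ∨ arR x y z = -1)
    (hx : x ∉ P) (hy : y ∉ P)
    (hxy : ¬ Disjoint (segment ℝ x y) P) (hyz : ¬ Disjoint (segment ℝ y z) P)
    (hzx : ¬ Disjoint (segment ℝ z x) P) :
    ∃ A ∈ P, ∃ k0 k1 k2 : ℤ, 1 ≤ k0 ∧ 1 ≤ k1 ∧ k2 ≤ -1 ∧ k0 + k1 + k2 = 1 ∧
      A.1 = k0 * x.1 + k1 * y.1 + k2 * z.1 ∧ A.2 = k0 * x.2 + k1 * y.2 + k2 * z.2 := by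
  obtain ⟨m1, m2, u, mx, mP⟩ := sep_pt hP hPc hx
  have my := sep_sign hxy mx mP
  have mz := sep_sign (by rwa [segment_symm]) (y := z) mx mP
  obtain ⟨n1, n2, w, ny, nP⟩ := sep_pt hP hPc hy
  have nx := sep_sign (by rwa [segment_symm]) (y := x) ny nP
  have nz := sep_sign hyz ny nP
  obtain ⟨d, hdd⟩ : ∃ d, d = arR x y z := ⟨_, rfl⟩
  have hd1 : d * d = 1 := by rw [hdd]; rcases hd with h | h <;> rw [h] <;> norm_num
  have hd2 : d = (y.1 - x.1) * (z.2 - x.2) - (y.2 - x.2) * (z.1 - x.1) := hdd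
  have hint : ∀ C ∈ latticeR2, ∃ k0 k1 k2 : ℤ, (k0 : ℝ) = d * arR C y z ∧
      (k1 : ℝ) = d * arR x C z ∧ (k2 : ℝ) = d * arR x y C := by
    rintro C ⟨C, rfl⟩
    obtain ⟨x, rfl⟩ := lx
    obtain ⟨y, rfl⟩ := ly
    obtain ⟨z, rfl⟩ := lz
    obtain ⟨e, he⟩ : ∃ e : ℤ, (e : ℝ) = d := by
      rcases hd with h | h
      · exact ⟨1, by rw [hdd, h]; simp⟩
      · exact ⟨-1, by rw [hdd, h]; simp⟩
    rw [← he]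
    exact ⟨e * ((y.1 - C.1) * (z.2 - C.2) - (y.2 - C.2) * (z.1 - C.1)),
      e * ((C.1 - x.1) * (z.2 - x.2) - (C.2 - x.2) * (z.1 - x.1)),
      e * ((y.1 - x.1) * (C.2 - x.2) - (y.2 - x.2) * (C.1 - x.1)),
      by simp [arR, vecR], by simp [arR, vecR], by simp [arR, vecR]⟩
  have hsum : ∀ C, d * arR C y z + d * arR x C z + d * arR x y C = 1 := by
    intro C; rw [← hd1]; conv_rhs => rw [hd2]
    rw [hd2]; unfold arR; ring
  have hc1 : ∀ C : ℝ × ℝ, C.1 = (d * arR C y z) * x.1 + (d * arR x C z) * y.1 +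
      (d * arR x y C) * z.1 := by
    intro C
    have : C.1 = (d * d) * C.1 := by rw [hd1, one_mul]
    rw [this, mul_assoc]; conv_lhs => rw [hd2]
    rw [hd2]; unfold arR; ring
  have hc2 : ∀ C : ℝ × ℝ, C.2 = (d * arR C y z) * x.2 + (d * arR x C z) * y.2 +
      (d * arR x y C) * z.2 := by
    intro C
    have : C.2 = (d * d) * C.2 := by rw [hd1, one_mul]
    rw [this, mul_assoc]; conv_lhs => rw [hd2]
    rw [hd2]; unfold arR; ring
  -- the far point
  obtain ⟨A, ⟨hAP, hAL⟩, hA⟩ : ∃ A ∈ P ∩ latticeR2, d * arR x y A < 0 := by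
    by_contra! hcon
    obtain ⟨p, ⟨s, t, hs, ht, hst, rfl⟩, hp⟩ := Set.not_disjoint_iff.1 hxy
    have hl : ∀ C : ℝ × ℝ, d * arR x y C = -((d * (y.2 - x.2)) * C.1 + (-d * (y.1 - x.1)) * C.2)
        + d * ((y.2 - x.2) * x.1 - (y.1 - x.1) * x.2) := by
      intro C; unfold arR; ring
    have hg : ∀ C : ℝ × ℝ, d * arR C y z = ((d * (y.2 - z.2)) * C.1 + (d * (z.1 - y.1)) * C.2)
        + d * (y.1 * z.2 - y.2 * z.1) := by
      intro C; unfold arR; ring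
    have hp0 : d * arR x y (s • x + t • y) = 0 := by
      have : s = 1 - t := by linarith
      unfold arR; simp [this]; right; ring
    have hp1 : d * arR (s • x + t • y) y z = s := by
      have h : t = 1 - s := by linarith
      have : s = d * d * s := by rw [hd1, one_mul]
      conv_rhs => rw [this, mul_assoc]; rw [hd2]
      rw [hd2]; unfold arR; simp [h]; left; ring
    have hs0 : 0 < s := by
      have := nP _ hp
      simp at this
      by_contra! h
      have h0 : s = 0 := le_antisymm h hs
      have h1 : t = 1 := by linarith
      rw [h0, h1] at this
      linarith
    obtain ⟨C, hC, hC0, hC1⟩ := lex_hull (hPh hp) (d * (y.2 - x.2)) (-d * (y.1 - x.1))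
      (d * (y.2 - z.2)) (d * (z.1 - y.1)) (d * ((y.2 - x.2) * x.1 - (y.1 - x.1) * x.2))
      (by intro C hC; have := hcon C hC; rw [hl] at this; linarith)
      (by rw [hl] at hp0; linarith)
    obtain ⟨k0, k1, k2, e0, e1, e2⟩ := hint C hC.2
    have hs' := hsum C
    have c1 := hc1 C
    have c2 := hc2 C
    have hk2 : (k2 : ℝ) = 0 := by rw [e2, hl]; linarith
    have hk0 : s ≤ (k0 : ℝ) := by rw [← hp1, e0, hg, hg]; linarith
    have hk0' : 1 ≤ k0 := by
      have : (0 : ℝ) < k0 := by linarith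
      have : 0 < k0 := by exact_mod_cast this
      omega
    have hk0'' : (1 : ℝ) ≤ k0 := by exact_mod_cast hk0'
    rw [← e0, ← e1, ← e2] at hs' c1 c2
    have := mP C hC.1
    rw [c1, c2, hk2] at this
    have hk1 : (k1 : ℝ) = 1 - k0 := by linarith
    rw [hk1] at this
    nlinarith
  obtain ⟨k0, k1, k2, e0, e1, e2⟩ := hint A hAL
  have hs' := hsum A
  have c1 := hc1 A
  have c2 := hc2 A
  rw [← e2] at hA
  rw [← e0, ← e1, ← e2] at hs' c1 c2
  have hmA := mP A hAP
  have hnA := nP A hAP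
  have hA' : k2 < 0 := by exact_mod_cast hA
  have hs'' : k0 + k1 + k2 = 1 := by exact_mod_cast hs'
  rw [c1, c2] at hmA hnA
  refine ⟨A, hAP, k0, k1, k2, ?_, ?_, by omega, hs'', c1, c2⟩
  · by_contra! hk
    have : (k0 : ℝ) ≤ 0 := by exact_mod_cast (by omega : k0 ≤ 0)
    have : (0 : ℝ) ≤ k1 := by linarith
    have i1 : (k0 : ℝ) * (n1 * x.1 + n2 * x.2 - w) ≤ 0 :=
      mul_nonpos_of_nonpos_of_nonneg (by linarith) (by linarith)
    have i2 : (k2 : ℝ) * (n1 * z.1 + n2 * z.2 - w) ≤ 0 :=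
      mul_nonpos_of_nonpos_of_nonneg (by linarith) (by linarith)
    have i3 : (k1 : ℝ) * (n1 * y.1 + n2 * y.2 - w) ≤ 0 :=
      mul_nonpos_of_nonneg_of_nonpos (by linarith) (by linarith)
    have : w = (k0 + k1 + k2) * w := by rw [hs', one_mul]
    linarith
  · by_contra! hk
    have : (k1 : ℝ) ≤ 0 := by exact_mod_cast (by omega : k1 ≤ 0)
    have : (0 : ℝ) ≤ k0 := by linarith
    have i1 : (k1 : ℝ) * (m1 * y.1 + m2 * y.2 - u) ≤ 0 :=
      mul_nonpos_of_nonpos_of_nonneg (by linarith) (by linarith)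
    have i2 : (k2 : ℝ) * (m1 * z.1 + m2 * z.2 - u) ≤ 0 :=
      mul_nonpos_of_nonpos_of_nonneg (by linarith) (by linarith)
    have i3 : (k0 : ℝ) * (m1 * x.1 + m2 * x.2 - u) ≤ 0 :=
      mul_nonpos_of_nonneg_of_nonpos (by linarith) (by linarith)
    have : u = (k0 + k1 + k2) * u := by rw [hs', one_mul]
    linarith

lemma no_unimod {P : Set (ℝ × ℝ)} (hP : Convex ℝ P) (hPc : IsClosed P)
    (hPh : P ⊆ convexHull ℝ (P ∩ latticeR2)) {x y z : ℝ × ℝ} (lx : x ∈ latticeR2)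
    (ly : y ∈ latticeR2) (lz : z ∈ latticeR2) (hd : arR x y z = 1 ∨ arR x y z = -1)
    (hx : x ∉ P) (hy : y ∉ P) (hz : z ∉ P)
    (hxy : ¬ Disjoint (segment ℝ x y) P) (hyz : ¬ Disjoint (segment ℝ y z) P)
    (hzx : ¬ Disjoint (segment ℝ z x) P) : False := by
  obtain ⟨A, hA, a0, a1, a2, p0, p1, p2, ps, A1, A2⟩ :=
    far_pt hP hPc hPh lx ly lz hd hx hy hxy hyz hzx
  have hd' : arR y z x = arR x y z := by unfold arR; ring
  obtain ⟨B, hB, b1, b2, b0, q1, q2, q0, qs, B1, B2⟩ :=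
    far_pt hP hPc hPh ly lz lx (by rwa [hd']) hy hz hyz hzx hxy
  obtain ⟨n1, n2, w, ny, nP⟩ := sep_pt hP hPc hy
  have nx := sep_sign (by rwa [segment_symm]) (y := x) ny nP
  have nz := sep_sign hyz ny nP
  have hmA := nP A hA
  have hmB := nP B hB
  rw [A1, A2] at hmA
  rw [B1, B2] at hmB
  obtain ⟨X, hX⟩ : ∃ X, X = n1 * x.1 + n2 * x.2 - w := ⟨_, rfl⟩
  obtain ⟨Y, hY⟩ : ∃ X, X = n1 * y.1 + n2 * y.2 - w := ⟨_, rfl⟩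
  obtain ⟨Z, hZ⟩ : ∃ X, X = n1 * z.1 + n2 * z.2 - w := ⟨_, rfl⟩
  have ps' : (a0 : ℝ) + a1 + a2 = 1 := by exact_mod_cast ps
  have qs' : (b1 : ℝ) + b2 + b0 = 1 := by exact_mod_cast qs
  have p0' : (1 : ℝ) ≤ a0 := by exact_mod_cast p0
  have p1' : (1 : ℝ) ≤ a1 := by exact_mod_cast p1
  have q1' : (1 : ℝ) ≤ b1 := by exact_mod_cast q1
  have q2' : (1 : ℝ) ≤ b2 := by exact_mod_cast q2
  have hA' : 0 < a0 * X + a1 * Y + a2 * Z := by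
    have : w = (a0 + a1 + a2) * w := by rw [ps', one_mul]
    rw [hX, hY, hZ]; linarith
  have hB' : 0 < b0 * X + b1 * Y + b2 * Z := by
    have : w = (b1 + b2 + b0) * w := by rw [qs', one_mul]
    rw [hX, hY, hZ]; linarith
  have X0 : 0 < X := by linarith
  have Z0 : 0 < Z := by linarith
  have Y0 : Y < 0 := by linarith
  have h1 : Z < X := by
    have e : (a2 : ℝ) = 1 - a0 - a1 := by linarith
    rw [e] at hA'
    have : 0 < a0 * (X - Z) := by nlinarith
    have := pos_of_mul_pos_right this (by linarith)
    linarith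
  have h2 : X < Z := by
    have e : (b0 : ℝ) = 1 - b1 - b2 := by linarith
    rw [e] at hB'
    have : 0 < b2 * (Z - X) := by nlinarith
    have := pos_of_mul_pos_right this (by linarith)
    linarith
  linarith

lemma no_collinear {P : Set (ℝ × ℝ)} (hP : Convex ℝ P) (hPc : IsClosed P)
    {x y z : ℝ × ℝ} (hd : arR x y z = 0)
    (hx : x ∉ P) (hy : y ∉ P) (hz : z ∉ P)
    (hxy : ¬ Disjoint (segment ℝ x y) P) (hyz : ¬ Disjoint (segment ℝ y z) P)
    (hzx : ¬ Disjoint (segment ℝ z x) P) : False := by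
  have main : ∀ a b c : ℝ, a + b + c = 0 → a * x.1 + b * y.1 + c * z.1 = 0 →
      a * x.2 + b * y.2 + c * z.2 = 0 → a = 0 ∧ b = 0 ∧ c = 0 := by
    have aux : ∀ x y z : ℝ × ℝ, x ∉ P → ¬ Disjoint (segment ℝ x y) P → 
        ¬ Disjoint (segment ℝ x z) P → ∀ a b c : ℝ, a + b + c = 0 → 
        a * x.1 + b * y.1 + c * z.1 = 0 → a * x.2 + b * y.2 + c * z.2 = 0 → 0 ≤ b → 0 ≤ c →
        a = 0 ∧ b = 0 ∧ c = 0 := by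
      intro x y z hx hxy hxz a b c hs h1 h2 hb hc
      obtain ⟨m1, m2, u, mx, mP⟩ := sep_pt hP hPc hx
      have my := sep_sign hxy mx mP
      have mz := sep_sign hxz mx mP
      have e : a * (m1 * x.1 + m2 * x.2 - u) + b * (m1 * y.1 + m2 * y.2 - u)
        + c * (m1 * z.1 + m2 * z.2 - u) = 0 := by
        linear_combination m1 * h1 + m2 * h2 - u * hs
      have i1 := mul_nonneg (by linarith : 0 ≤ -a) (by linarith : 0 ≤ -(m1 * x.1 + m2 * x.2 - u))
      have i2 := mul_nonneg hb (by linarith : 0 ≤ (m1 * y.1 + m2 * y.2 - u))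
      have i3 := mul_nonneg hc (by linarith : 0 ≤ (m1 * z.1 + m2 * z.2 - u))
      have j2 : b * (m1 * y.1 + m2 * y.2 - u) = 0 := by nlinarith
      have j3 : c * (m1 * z.1 + m2 * z.2 - u) = 0 := by nlinarith
      have b0 : b = 0 := (mul_eq_zero.1 j2).resolve_right (by linarith)
      have c0 : c = 0 := (mul_eq_zero.1 j3).resolve_right (by linarith)
      exact ⟨by linarith, b0, c0⟩
    have aux' : ∀ x y z : ℝ × ℝ, x ∉ P → ¬ Disjoint (segment ℝ x y) P → 
        ¬ Disjoint (segment ℝ x z) P → ∀ a b c : ℝ, a + b + c = 0 → 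
        a * x.1 + b * y.1 + c * z.1 = 0 → a * x.2 + b * y.2 + c * z.2 = 0 → 0 ≤ b * c →
        a = 0 ∧ b = 0 ∧ c = 0 := by
      intro x y z hx hxy hxz a b c hs h1 h2 hbc
      rcases mul_nonneg_iff.1 hbc with ⟨hb, hc⟩ | ⟨hb, hc⟩
      · exact aux x y z hx hxy hxz a b c hs h1 h2 hb hc
      · have := aux x y z hx hxy hxz (-a) (-b) (-c) (by linarith) (by linarith) (by linarith)
          (by linarith) (by linarith)
        simpa using this
    have hyx := hxy
    have hzy := hyz
    have hxz := hzx
    rw [segment_symm] at hyx hzy hxz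
    intro a b c hs h1 h2
    by_cases bc : 0 ≤ b * c
    · exact aux' x y z hx hxy hxz a b c hs h1 h2 bc
    by_cases ca : 0 ≤ c * a
    · have := aux' y z x hy hyz hyx b c a (by linarith) (by linarith) (by linarith) ca
      tauto
    by_cases ab : 0 ≤ a * b
    · have := aux' z x y hz hzx hzy c a b (by linarith) (by linarith) (by linarith) ab
      tauto
    exfalso
    push Not at bc ca ab
    have : c = -a - b := by linarith
    rw [this] at bc ca
    nlinarith [sq_nonneg a, sq_nonneg b]
  have m1 := main (y.1 - z.1) (z.1 - x.1) (x.1 - y.1) (by ring) (by ring)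
    (by unfold arR at hd; linear_combination -hd)
  have m2 := main (y.2 - z.2) (z.2 - x.2) (x.2 - y.2) (by ring)
    (by unfold arR at hd; linear_combination hd) (by ring)
  have : x = y := by ext <;> linarith
  rw [this, segment_same, Set.disjoint_singleton_left] at hxy
  exact hxy hy

/-- integer version of `arR` -/
def arZ (x y z : ℤ × ℤ) : ℤ := (y.1 - x.1) * (z.2 - x.2) - (y.2 - x.2) * (z.1 - x.1)

lemma arR_vecR (x y z : ℤ × ℤ) : arR (vecR x) (vecR y) (vecR z) = arZ x y z := by
  simp [arR, arZ, vecR]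

lemma inner_pt (x y z : ℤ × ℤ) (hD : 2 ≤ (arZ x y z).natAbs) :
    ∃ u : ℤ × ℤ, ∃ a b c : ℝ, 0 ≤ a ∧ 0 ≤ b ∧ 0 ≤ c ∧ a < 1 ∧ b < 1 ∧ c < 1 ∧ a + b + c = 1 ∧
      (vecR u).1 = a * (vecR x).1 + b * (vecR y).1 + c * (vecR z).1 ∧
      (vecR u).2 = a * (vecR x).2 + b * (vecR y).2 + c * (vecR z).2 := by
  obtain ⟨D, hDD⟩ : ∃ D, D = arZ x y z := ⟨_, rfl⟩
  rw [← hDD] at hD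
  have hD0 : D ≠ 0 := by rintro rfl; simp at hD
  have hD0' : (D : ℝ) ≠ 0 := by exact_mod_cast hD0
  obtain ⟨m, hm⟩ : ∃ m : ℤ × ℤ, ¬ (D ∣ m.1 * (z.2 - x.2) - m.2 * (z.1 - x.1) ∧
      D ∣ (y.1 - x.1) * m.2 - (y.2 - x.2) * m.1) := by
    by_contra! h
    obtain ⟨⟨p, hp⟩, ⟨q, hq⟩⟩ := h (1, 0)
    obtain ⟨⟨r, hr⟩, ⟨s, hs⟩⟩ := h (0, 1)
    simp at hp hq hr hs
    have : D = D * (D * (s * p - q * r)) := by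
      conv_lhs => rw [hDD]
      unfold arZ
      rw [hp, hs]
      linear_combination (-(D * r)) * hq + (y.2 - x.2) * hr
    have h1 : D * (s * p - q * r) = 1 := by
      have : D * 1 = D * (D * (s * p - q * r)) := by linarith
      exact (mul_left_cancel₀ hD0 this).symm
    have := Int.isUnit_iff_natAbs_eq.1 (IsUnit.of_mul_eq_one _ h1)
    omega
  obtain ⟨s, hs⟩ : ∃ s : ℝ, s = ((m.1 * (z.2 - x.2) - m.2 * (z.1 - x.1) : ℤ) : ℝ) / D := ⟨_, rfl⟩
  obtain ⟨t, ht⟩ : ∃ s : ℝ, s = (((y.1 - x.1) * m.2 - (y.2 - x.2) * m.1 : ℤ) : ℝ) / D := ⟨_, rfl⟩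
  have hst : 0 < Int.fract s ∨ 0 < Int.fract t := by
    by_contra! h
    have h1 : Int.fract s = 0 := le_antisymm h.1 (Int.fract_nonneg s)
    have h2 : Int.fract t = 0 := le_antisymm h.2 (Int.fract_nonneg t)
    apply hm
    have e1 := Int.floor_add_fract s
    have e2 := Int.floor_add_fract t
    rw [h1, add_zero] at e1
    rw [h2, add_zero] at e2
    constructor
    · refine ⟨⌊s⌋, ?_⟩
      have : ((m.1 * (z.2 - x.2) - m.2 * (z.1 - x.1) : ℤ) : ℝ) = D * (⌊s⌋ : ℝ) := by
        rw [e1, hs]; field_simp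
      exact_mod_cast this
    · refine ⟨⌊t⌋, ?_⟩
      have : (((y.1 - x.1) * m.2 - (y.2 - x.2) * m.1 : ℤ) : ℝ) = D * (⌊t⌋ : ℝ) := by
        rw [e2, ht]; field_simp
      exact_mod_cast this
  have hDR : (D : ℝ) = ((y.1 : ℝ) - x.1) * (z.2 - x.2) - (y.2 - x.2) * (z.1 - x.1) := by
    rw [hDD]; simp [arZ]
  have hm1 : (m.1 : ℝ) = s * (y.1 - x.1) + t * (z.1 - x.1) := by
    rw [hs, ht]; field_simp; push_cast; rw [hDR]; ring
  have hm2 : (m.2 : ℝ) = s * (y.2 - x.2) + t * (z.2 - x.2) := by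
    rw [hs, ht]; field_simp; push_cast; rw [hDR]; ring
  have e1 : Int.fract s = s - ⌊s⌋ := rfl
  have e2 : Int.fract t = t - ⌊t⌋ := rfl
  have f0 := Int.fract_nonneg s
  have f1 := Int.fract_lt_one s
  have g0 := Int.fract_nonneg t
  have g1 := Int.fract_lt_one t
  rcases le_or_gt (Int.fract s + Int.fract t) 1 with h | h
  · refine ⟨(x.1 + m.1 - ⌊s⌋ * (y.1 - x.1) - ⌊t⌋ * (z.1 - x.1),
      x.2 + m.2 - ⌊s⌋ * (y.2 - x.2) - ⌊t⌋ * (z.2 - x.2)), 1 - Int.fract s - Int.fract t,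
      Int.fract s, Int.fract t, by linarith, f0, g0, ?_, f1, g1, by ring, ?_, ?_⟩
    · rcases hst with h | h <;> linarith
    · simp only [vecR]; push_cast; rw [hm1, e1, e2]; ring
    · simp only [vecR]; push_cast; rw [hm2, e1, e2]; ring
  · refine ⟨(y.1 + z.1 - x.1 - m.1 + ⌊s⌋ * (y.1 - x.1) + ⌊t⌋ * (z.1 - x.1),
      y.2 + z.2 - x.2 - m.2 + ⌊s⌋ * (y.2 - x.2) + ⌊t⌋ * (z.2 - x.2)),
      Int.fract s + Int.fract t - 1,
      1 - Int.fract s, 1 - Int.fract t, by linarith, by linarith, by linarith, by linarith,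
      by linarith, by linarith, by ring, ?_, ?_⟩
    · simp only [vecR]; push_cast; rw [hm1, e1, e2]; ring
    · simp only [vecR]; push_cast; rw [hm2, e1, e2]; ring

lemma no_three {P Q : Set (ℝ × ℝ)} (hP : Convex ℝ P) (hPc : IsClosed P)
    (hPh : P ⊆ convexHull ℝ (P ∩ latticeR2))
    (hQ : Convex ℝ Q) (hno : ∀ u ∈ latticeR2, u ∈ P → u ∉ Q) (N : ℕ) :
    ∀ x y z : ℤ × ℤ, (arZ x y z).natAbs = N → vecR x ∈ Q → vecR y ∈ Q → vecR z ∈ Q →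
    ¬ Disjoint (segment ℝ (vecR x) (vecR y)) P → ¬ Disjoint (segment ℝ (vecR y) (vecR z)) P →
    ¬ Disjoint (segment ℝ (vecR z) (vecR x)) P → False := by
  induction N using Nat.strong_induction_on with
  | _ N ih =>
  intro x y z hN hx hy hz hxy hyz hzx
  have nP : ∀ u : ℤ × ℤ, vecR u ∈ Q → vecR u ∉ P := fun u hu hp => hno _ ⟨u, rfl⟩ hp hu
  rcases (by omega : (arZ x y z).natAbs = 0 ∨ (arZ x y z).natAbs = 1 ∨ 2 ≤ (arZ x y z).natAbs) with
    h | h | h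
  · exact no_collinear hP hPc (by rw [arR_vecR]; simpa using h) (nP _ hx) (nP _ hy) (nP _ hz)
      hxy hyz hzx
  · refine no_unimod hP hPc hPh ⟨x, rfl⟩ ⟨y, rfl⟩ ⟨z, rfl⟩ ?_ (nP _ hx) (nP _ hy) (nP _ hz)
      hxy hyz hzx
    rw [arR_vecR]
    rcases Int.natAbs_eq_iff.1 h with h | h
    · left; rw [h]; simp
    · right; rw [h]; simp
  · obtain ⟨u, a, b, c, a0, b0, c0, a1, b1, c1, hs, u1, u2⟩ := inner_pt x y z h
    have hu : vecR u ∈ Q := mem_comb3 hQ hx hy hz a b c a0 b0 c0 hs u1 u2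
    have small : ∀ (r : ℝ) (E : ℤ), 0 ≤ r → r < 1 → (E : ℝ) = r * arZ x y z → E.natAbs < N := by
      intro r E r0 r1 hE
      rw [← hN]
      have : ((E.natAbs : ℤ) : ℝ) < (((arZ x y z).natAbs : ℤ) : ℝ) := by
        rw [Int.natCast_natAbs, Int.natCast_natAbs, Int.cast_abs, Int.cast_abs, hE, abs_mul,
          abs_of_nonneg r0]
        have : (0 : ℝ) < |(arZ x y z : ℝ)| := by
          rw [abs_pos]
          have : arZ x y z ≠ 0 := by intro h'; rw [h'] at h; simp at h
          exact_mod_cast this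
        nlinarith
      exact_mod_cast this
    have ha : a = 1 - b - c := by linarith
    have tr : ∀ p q r : ℤ × ℤ, vecR p ∈ Q → vecR q ∈ Q → vecR r ∈ Q →
        Disjoint (segment ℝ (vecR p) (vecR r)) P → Disjoint (segment ℝ (vecR r) (vecR q)) P →
        Disjoint (segment ℝ (vecR p) (vecR q)) P := fun p q r hp hq hr h1 h2 =>
      seg_trans hP hPh hQ hno hp hq hr h1 h2
    by_cases hux : Disjoint (segment ℝ (vecR u) (vecR x)) P
    · refine ih _ (small a (arZ u y z) a0 a1 ?_) u y z rfl hu hy hz ?_ hyz ?_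
      · rw [← arR_vecR, ← arR_vecR]; unfold arR; rw [u1, u2, ha]; ring
      · intro h; exact hxy (tr _ _ _ hx hy hu (disj_symm.1 hux) h)
      · intro h; exact hzx (tr _ _ _ hz hx hu h hux)
    by_cases huy : Disjoint (segment ℝ (vecR u) (vecR y)) P
    · refine ih _ (small b (arZ x u z) b0 b1 ?_) x u z rfl hx hu hz ?_ ?_ hzx
      · rw [← arR_vecR, ← arR_vecR]; unfold arR; rw [u1, u2, ha]; ring
      · intro h; exact hxy (tr _ _ _ hx hy hu h huy)
      · intro h; exact hyz (tr _ _ _ hy hz hu (disj_symm.1 huy) h)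
    · refine ih _ (small c (arZ x y u) c0 c1 ?_) x y u rfl hx hy hu hxy ?_ hux
      · rw [← arR_vecR, ← arR_vecR]; unfold arR; rw [u1, u2, ha]; ring
      · intro h; exact huy (disj_symm.1 h)

lemma exists_dir (l1 l2 r1 r2 : ℝ) : ∃ D : ℝ × ℝ, D ≠ 0 ∧ 0 ≤ l1 * D.1 + l2 * D.2 ∧
    0 ≤ r1 * D.1 + r2 * D.2 := by
  have : ∃ D : ℝ × ℝ, D ≠ 0 ∧ l1 * D.1 + l2 * D.2 = 0 := by
    by_cases h : l1 = 0
    · exact ⟨(1, 0), by simp, by simp [h]⟩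
    · exact ⟨(-l2, l1), by simp [h], by simp; ring⟩
  obtain ⟨D, h0, h1⟩ := this
  rcases le_total 0 (r1 * D.1 + r2 * D.2) with h | h
  · exact ⟨D, h0, h1.ge, h⟩
  · refine ⟨-D, by simpa using h0, ?_, ?_⟩ <;> simp <;> linarith

lemma step_exists (p : ℕ → Prop) (k : ℕ) (h0 : p 0) (hk : ¬ p k) :
    ∃ i < k, p i ∧ ¬ p (i + 1) := by
  by_contra! h
  have : ∀ i ≤ k, p i := by
    intro i
    induction i with
    | zero => exact fun _ => h0
    | succ i ih => exact fun hi => h i (by omega) (ih (by omega))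
  exact hk (this k le_rfl)

lemma latt_add {x y : ℝ × ℝ} (hx : x ∈ latticeR2) (hy : y ∈ latticeR2) : x + y ∈ latticeR2 := by
  obtain ⟨m, rfl⟩ := hx
  obtain ⟨k, rfl⟩ := hy
  exact ⟨m + k, by simp [vecR]⟩

lemma latt_sub {x y : ℝ × ℝ} (hx : x ∈ latticeR2) (hy : y ∈ latticeR2) : x - y ∈ latticeR2 := by
  obtain ⟨m, rfl⟩ := hx
  obtain ⟨k, rfl⟩ := hy
  exact ⟨m - k, by simp [vecR]⟩

lemma latt_perp (w : ℤ × ℤ) (hw : IsCoprime w.1 w.2) {x : ℝ × ℝ} (hx : x ∈ latticeR2)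
    (h : dotR x (vecR w) = 0) : ∃ k : ℤ, x = (k : ℝ) • vecR (-w.2, w.1) := by
  obtain ⟨m, rfl⟩ := hx
  obtain ⟨a, b, hab⟩ := hw
  have h' : m.1 * w.1 + m.2 * w.2 = 0 := by
    simp only [dotR, vecR] at h; exact_mod_cast h
  refine ⟨a * m.2 - b * m.1, ?_⟩
  have e1 : m.1 = (a * m.2 - b * m.1) * (-w.2) := by
    linear_combination -m.1 * hab + a * h'
  have e2 : m.2 = (a * m.2 - b * m.1) * w.1 := by
    linear_combination -m.2 * hab + b * h'
  have e1' : (m.1 : ℝ) = ((a * m.2 - b * m.1 : ℤ) : ℝ) * ((-w.2 : ℤ) : ℝ) := by exact_mod_cast e1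
  have e2' : (m.2 : ℝ) = ((a * m.2 - b * m.1 : ℤ) : ℝ) * ((w.1 : ℤ) : ℝ) := by exact_mod_cast e2
  ext
  · simpa [vecR] using e1'
  · simpa [vecR] using e2'

lemma real_perp (w : ℤ × ℤ) (hw : IsCoprime w.1 w.2) {x : ℝ × ℝ}
    (h : dotR x (vecR w) = 0) : ∃ k : ℝ, x = k • vecR (-w.2, w.1) := by
  obtain ⟨a, b, hab⟩ := hw
  have hab' : (a : ℝ) * w.1 + b * w.2 = 1 := by exact_mod_cast hab
  simp only [dotR, vecR] at h
  refine ⟨a * x.2 - b * x.1, ?_⟩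
  ext
  · simp [vecR]; linear_combination -x.1 * hab' + a * h
  · simp [vecR]; linear_combination -x.2 * hab' + b * h

lemma convex_half {ι : Type*} (v : ι → ℤ × ℤ) (c : ι → ℝ) :
    Convex ℝ {u : ℝ × ℝ | ∀ i, dotR u (vecR (v i)) ≤ c i} := by
  intro x hx y hy s t hs ht hst i
  have h1 := mul_le_mul_of_nonneg_left (hx i) hs
  have h2 := mul_le_mul_of_nonneg_left (hy i) ht
  have h3 : s * c i + t * c i = c i := by rw [← add_mul, hst, one_mul]
  have : dotR (s • x + t • y) (vecR (v i)) = s * dotR x (vecR (v i)) + t * dotR y (vecR (v i)) := by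
    simp [dotR]; ring
  rw [this]; linarith

lemma core {ι : Type*} [Finite ι] (v : ι → ℤ × ℤ) (c : ι → ℝ) (P Q : Set (ℝ × ℝ))
    (hQd : Q = {u | ∀ i, dotR u (vecR (v i)) ≤ c i})
    (hcop : ∀ i, IsCoprime (v i).1 (v i).2)
    (hpos : ∀ D : ℝ × ℝ, D ≠ 0 → ∃ j, 0 < dotR D (vecR (v j)))
    (hP : Convex ℝ P) (hPc : IsClosed P) (hPh : P ⊆ convexHull ℝ (P ∩ latticeR2))
    (hQh : Q ⊆ convexHull ℝ (Q ∩ latticeR2)) (hfin : (Q ∩ latticeR2).Finite)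
    (hbase : ∀ j, ∃ b ∈ P, b + vecR (-(v j).2, (v j).1) ∈ P ∧ dotR b (vecR (v j)) ≤ c j)
    {p : ℝ × ℝ} (hpP : p ∈ P) (hpQ : p ∈ Q) : ∃ u ∈ latticeR2, u ∈ P ∧ u ∈ Q := by
  by_contra! hno
  have hQ : Convex ℝ Q := by rw [hQd]; exact convex_half v c
  obtain ⟨x0, hx0⟩ : (Q ∩ latticeR2).Nonempty := by
    rw [← convexHull_nonempty_iff (𝕜 := ℝ)]; exact ⟨p, hQh hpQ⟩
  have tr : ∀ p q r : ℝ × ℝ, p ∈ Q → q ∈ Q → r ∈ Q →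
        Disjoint (segment ℝ p r) P → Disjoint (segment ℝ r q) P →
        Disjoint (segment ℝ p q) P := fun p q r hp hq hr h1 h2 =>
      seg_trans hP hPh hQ hno hp hq hr h1 h2
  let X1 : Set (ℝ × ℝ) := {x ∈ Q ∩ latticeR2 | Disjoint (segment ℝ x0 x) P}
  let X2 : Set (ℝ × ℝ) := {x ∈ Q ∩ latticeR2 | ¬ Disjoint (segment ℝ x0 x) P}
  have d1 : Disjoint (convexHull ℝ X1) P := by
    refine class_hull hP hPh hQ hno (fun x hx => hx.1.1) ?_
    intro x hx y hy
    exact tr _ _ x0 hx.1.1 hy.1.1 hx0.1 (disj_symm.1 hx.2) hy.2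
  have d2 : Disjoint (convexHull ℝ X2) P := by
    refine class_hull hP hPh hQ hno (fun x hx => hx.1.1) ?_
    rintro x ⟨⟨hx, ⟨x, rfl⟩⟩, hx'⟩ y ⟨⟨hy, ⟨y, rfl⟩⟩, hy'⟩
    by_contra hxy
    obtain ⟨hx0, ⟨x0, rfl⟩⟩ := hx0
    exact no_three hP hPc hPh hQ hno _ x0 x y rfl hx0 hx hy hx' hxy
      (by rwa [segment_symm])
  have f1 : X1.Finite := hfin.subset (fun x hx => hx.1)
  have f2 : X2.Finite := hfin.subset (fun x hx => hx.1)
  obtain ⟨l1, l2, lu, hl, hlP⟩ := sep_sets hP hPc (convex_convexHull ℝ X1)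
    (f1.isCompact_convexHull (𝕜 := ℝ)) d1
  obtain ⟨r1, r2, ru, hr, hrP⟩ := sep_sets hP hPc (convex_convexHull ℝ X2)
    (f2.isCompact_convexHull (𝕜 := ℝ)) d2
  have hl1 : ∀ x ∈ X1, l1 * x.1 + l2 * x.2 < lu := fun x hx => hl x (subset_convexHull ℝ _ hx)
  have hr2 : ∀ x ∈ X2, r1 * x.1 + r2 * x.2 < ru := fun x hx => hr x (subset_convexHull ℝ _ hx)
  obtain ⟨D, hD0, hDl, hDr⟩ := exists_dir l1 l2 r1 r2
  obtain ⟨j0, hj0⟩ := hpos D hD0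
  obtain ⟨j, hj, hjmin⟩ := Set.exists_min_image {j | 0 < dotR D (vecR (v j))}
    (fun j => (c j - dotR p (vecR (v j))) / dotR D (vecR (v j))) (Set.toFinite _) ⟨j0, hj0⟩
  simp only [Set.mem_setOf_eq] at hj hjmin
  have hpQ' : ∀ i, dotR p (vecR (v i)) ≤ c i := by rw [hQd] at hpQ; exact hpQ
  obtain ⟨τ, hτ⟩ : ∃ τ, τ = (c j - dotR p (vecR (v j))) / dotR D (vecR (v j)) := ⟨_, rfl⟩
  rw [← hτ] at hjmin
  have hτ0 : 0 ≤ τ := by rw [hτ]; exact div_nonneg (by linarith [hpQ' j]) hj.le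
  have hdq : ∀ i, dotR (p + τ • D) (vecR (v i)) =
      dotR p (vecR (v i)) + τ * dotR D (vecR (v i)) := by
    intro i; simp [dotR]; ring
  have hqQ : p + τ • D ∈ Q := by
    rw [hQd]
    intro i
    rw [hdq]
    by_cases hi : 0 < dotR D (vecR (v i))
    · have := hjmin i hi
      rw [le_div_iff₀ hi] at this
      linarith
    · have := mul_nonneg hτ0 (by linarith : 0 ≤ - dotR D (vecR (v i)))
      linarith [hpQ' i]
  have hqj : dotR (p + τ • D) (vecR (v j)) = c j := by
    rw [hdq, hτ]; field_simp; ring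
  have hql : lu < l1 * (p + τ • D).1 + l2 * (p + τ • D).2 := by
    have h1 := hlP p hpP
    have h2 := mul_nonneg hτ0 hDl
    simp; linarith
  have hqr : ru < r1 * (p + τ • D).1 + r2 * (p + τ • D).2 := by
    have h1 := hrP p hpP
    have h2 := mul_nonneg hτ0 hDr
    simp; linarith
  have hXf : ∀ x ∈ Q ∩ latticeR2, ((v j).1 : ℝ) * x.1 + (v j).2 * x.2 ≤ c j := by
    rintro x ⟨hx, -⟩
    rw [hQd] at hx
    have := hx j
    simp only [dotR, vecR] at this
    linarith
  have hqj' : ((v j).1 : ℝ) * (p + τ • D).1 + (v j).2 * (p + τ • D).2 = c j := by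
    simp only [dotR, vecR] at hqj
    linarith
  obtain ⟨y', hy', hyj, hyl⟩ := lex_hull (hQh hqQ) (v j).1 (v j).2 l1 l2 (c j) hXf hqj'
  obtain ⟨x', hx', hxj, hxr⟩ := lex_hull (hQh hqQ) (v j).1 (v j).2 r1 r2 (c j) hXf hqj'
  have hy2 : ¬ Disjoint (segment ℝ x0 y') P := by
    intro h
    have := hl1 y' ⟨hy', h⟩
    linarith
  have hx1 : Disjoint (segment ℝ x0 x') P := by
    by_contra h
    have := hr2 x' ⟨hx', h⟩
    linarith
  have hlE : 0 < l1 * (y' - x').1 + l2 * (y' - x').2 := by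
    have := hl1 x' ⟨hx', hx1⟩
    simp; linarith
  have hrE : r1 * (y' - x').1 + r2 * (y' - x').2 < 0 := by
    have := hr2 y' ⟨hy', hy2⟩
    simp; linarith
  -- the primitive step
  obtain ⟨k, hk⟩ := latt_perp (v j) (hcop j) (latt_sub hy'.2 hx'.2) (by
    simp only [dotR, vecR, Prod.fst_sub, Prod.snd_sub]; linarith)
  obtain ⟨E, N, hEN, hEL, hEj, hbE⟩ : ∃ E : ℝ × ℝ, ∃ N : ℕ, y' - x' = (N : ℝ) • E ∧ E ∈ latticeR2 ∧
      (∀ x : ℝ × ℝ, dotR x (vecR (v j)) = 0 → ∃ r : ℝ, x = r • E) ∧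
      ∃ b ∈ P, b + E ∈ P ∧ dotR b (vecR (v j)) ≤ c j := by
    obtain ⟨b, hb, hb', hbc⟩ := hbase j
    have hperp : dotR (vecR (-(v j).2, (v j).1)) (vecR (v j)) = 0 := by
      simp [dotR, vecR]; ring
    obtain ⟨N, rfl | rfl⟩ := Int.eq_nat_or_neg k
    · refine ⟨vecR (-(v j).2, (v j).1), N, by simpa using hk, ⟨_, rfl⟩,
        fun x hx => real_perp _ (hcop j) hx, b, hb, hb', hbc⟩
    · refine ⟨- vecR (-(v j).2, (v j).1), N, by simpa using hk,
        ⟨-(-(v j).2, (v j).1), by simp [vecR]⟩, ?_, b + vecR (-(v j).2, (v j).1), hb',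
        by simpa using hb, ?_⟩
      · intro x hx
        obtain ⟨r, hr⟩ := real_perp _ (hcop j) hx
        exact ⟨-r, by rw [hr]; simp⟩
      · have : dotR (b + vecR (-(v j).2, (v j).1)) (vecR (v j)) =
          dotR b (vecR (v j)) + dotR (vecR (-(v j).2, (v j).1)) (vecR (v j)) := by
          simp [dotR]; ring
        rw [this, hperp]; linarith
  obtain ⟨b, hbP, hbP', hbc⟩ := hbE
  have hN0 : (0 : ℝ) ≤ N := Nat.cast_nonneg N
  have hlE' : 0 < l1 * E.1 + l2 * E.2 := by
    rw [hEN] at hlE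
    have : 0 < (N : ℝ) * (l1 * E.1 + l2 * E.2) := by simp at hlE; linarith
    exact pos_of_mul_pos_right this hN0
  have hrE' : r1 * E.1 + r2 * E.2 < 0 := by
    rw [hEN] at hrE
    have : 0 < (N : ℝ) * (-(r1 * E.1 + r2 * E.2)) := by simp at hrE; linarith
    linarith [pos_of_mul_pos_right this hN0]
  have hy'x' : y' = x' + (N : ℝ) • E := by rw [← hEN]; abel
  obtain ⟨i, hiN, hi, hi'⟩ := step_exists (fun i => Disjoint (segment ℝ x0 (x' + (i : ℝ) • E)) P) N
    (by simpa using hx1) (by simpa [← hy'x'] using hy2)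
  have hstepL : ∀ i : ℕ, x' + (i : ℝ) • E ∈ latticeR2 := by
    intro i
    refine latt_add hx'.2 ?_
    obtain ⟨m, rfl⟩ := hEL
    exact ⟨((i : ℤ) * m.1, (i : ℤ) * m.2), by simp [vecR]⟩
  have hstepQ : ∀ i : ℕ, i ≤ N → x' + (i : ℝ) • E ∈ Q := by
    intro i hi
    have hNpos : (0 : ℝ) < N := by exact_mod_cast (by omega : 0 < N)
    have hiR : (i : ℝ) ≤ N := by exact_mod_cast hi
    refine mem_comb2 hQ hx'.1 hy'.1 (1 - i / N) (i / N) ?_ (by positivity) (by ring) ?_ ?_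
    · rw [sub_nonneg, div_le_one hNpos]; exact hiR
    · rw [hy'x']; simp; field_simp; ring
    · rw [hy'x']; simp; field_simp; ring
  have hxX := hl1 (x' + (i : ℝ) • E) ⟨⟨hstepQ i hiN.le, hstepL i⟩, hi⟩
  have hyX := hr2 (x' + ((i + 1 : ℕ) : ℝ) • E) ⟨⟨hstepQ (i + 1) hiN, hstepL (i + 1)⟩, hi'⟩
  have hbl := hlP b hbP
  have hbr := hrP _ hbP'
  -- the contradiction
  obtain ⟨G, hG⟩ : ∃ G, G = b - (x' + (i : ℝ) • E) := ⟨_, rfl⟩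
  have hGl : 0 < l1 * G.1 + l2 * G.2 := by rw [hG]; simp at hxX ⊢; linarith
  have hGr : 0 < r1 * G.1 + r2 * G.2 := by rw [hG]; simp at hyX hbr ⊢; linarith
  have hE0 : dotR (y' - x') (vecR (v j)) = 0 := by
    simp only [dotR, vecR, Prod.fst_sub, Prod.snd_sub]; linarith
  have hE0' : dotR E (vecR (v j)) = 0 := by
    rw [hEN] at hE0
    have hNpos : (N : ℝ) ≠ 0 := by exact_mod_cast (by omega : N ≠ 0)
    have : (N : ℝ) * dotR E (vecR (v j)) = 0 := by rw [← hE0]; simp [dotR]; ring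
    exact (mul_eq_zero.1 this).resolve_left hNpos
  have hGj : dotR G (vecR (v j)) ≤ 0 := by
    have e : dotR G (vecR (v j)) = dotR b (vecR (v j)) - dotR x' (vecR (v j))
        - i * dotR E (vecR (v j)) := by rw [hG]; simp [dotR]; ring
    have e2 : dotR x' (vecR (v j)) = c j := by simp only [dotR, vecR]; linarith
    rw [e, e2, hE0']; linarith
  obtain ⟨ρ, hρ⟩ := hEj (dotR D (vecR (v j)) • G + (-dotR G (vecR (v j))) • D) (by
    simp [dotR]; ring)
  have hl' : 0 < ρ * (l1 * E.1 + l2 * E.2) := by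
    have h1 := congrArg Prod.fst hρ
    have h2 := congrArg Prod.snd hρ
    simp only [Prod.fst_add, Prod.snd_add, Prod.smul_fst, Prod.smul_snd, smul_eq_mul] at h1 h2
    have : ρ * (l1 * E.1 + l2 * E.2) = dotR D (vecR (v j)) * (l1 * G.1 + l2 * G.2)
      + (-dotR G (vecR (v j))) * (l1 * D.1 + l2 * D.2) := by
      linear_combination -l1 * h1 - l2 * h2
    rw [this]
    have i1 := mul_pos hj hGl
    have i2 := mul_nonneg (by linarith : 0 ≤ -dotR G (vecR (v j))) hDl
    linarith
  have hr' : 0 < ρ * (r1 * E.1 + r2 * E.2) := by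
    have h1 := congrArg Prod.fst hρ
    have h2 := congrArg Prod.snd hρ
    simp only [Prod.fst_add, Prod.snd_add, Prod.smul_fst, Prod.smul_snd, smul_eq_mul] at h1 h2
    have : ρ * (r1 * E.1 + r2 * E.2) = dotR D (vecR (v j)) * (r1 * G.1 + r2 * G.2)
      + (-dotR G (vecR (v j))) * (r1 * D.1 + r2 * D.2) := by
      linear_combination -r1 * h1 - r2 * h2
    rw [this]
    have i1 := mul_pos hj hGr
    have i2 := mul_nonneg (by linarith : 0 ≤ -dotR G (vecR (v j))) hDr
    linarith
  have hρ0 : 0 < ρ := pos_of_mul_pos_left hl' hlE'.le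
  nlinarith

/-- sets all of whose linear functionals are minimised at lattice points -/
lemma fin_of_min {S : Set (ℝ × ℝ)} (h : ∀ ξ : ℝ × ℝ, ∃ u ∈ S ∩ latticeR2, ∀ s ∈ S,
    dotR u ξ ≤ dotR s ξ) : (S ∩ latticeR2).Finite := by
  obtain ⟨a, -, ha⟩ := h (1, 0)
  obtain ⟨b, -, hb⟩ := h (-1, 0)
  obtain ⟨c, -, hc⟩ := h (0, 1)
  obtain ⟨d, -, hd⟩ := h (0, -1)
  simp [dotR] at ha hb hc hd
  refine ((Set.finite_Icc ((⌈a.1⌉, ⌈c.2⌉) : ℤ × ℤ) (⌊b.1⌋, ⌊d.2⌋)).image vecR).subset ?_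
  rintro s ⟨hs, ⟨m, rfl⟩⟩
  refine ⟨m, ⟨⟨?_, ?_⟩, ⟨?_, ?_⟩⟩, rfl⟩
  · exact Int.ceil_le.2 (ha _ _ hs)
  · exact Int.ceil_le.2 (hc _ _ hs)
  · exact Int.le_floor.2 (hb _ _ hs)
  · exact Int.le_floor.2 (hd _ _ hs)

lemma hull_of_min {S : Set (ℝ × ℝ)} (h : ∀ ξ : ℝ × ℝ, ∃ u ∈ S ∩ latticeR2, ∀ s ∈ S,
    dotR u ξ ≤ dotR s ξ) : S ⊆ convexHull ℝ (S ∩ latticeR2) := by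
  intro x hx
  by_contra hcon
  obtain ⟨m1, m2, t, h1, h2⟩ := sep_pt (convex_convexHull ℝ (S ∩ latticeR2))
    ((fin_of_min h).isCompact_convexHull (𝕜 := ℝ)).isClosed hcon
  obtain ⟨u, hu, hmin⟩ := h (m1, m2)
  have k1 := hmin x hx
  have k2 := h2 u (subset_convexHull ℝ _ hu)
  simp only [dotR] at k1
  linarith

section Fan

lemma fan_cone {n : ℕ} {v : ZMod n → ℤ × ℤ} (hv : IsCompleteSmoothFan n v) (i j : ZMod n)
    (h1 : 0 < (v j).1 * (v (i + 1)).2 - (v j).2 * (v (i + 1)).1)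
    (h2 : 0 < (v i).1 * (v j).2 - (v i).2 * (v j).1) : False := by
  obtain ⟨-, hdet, huni⟩ := hv
  have hd := hdet i
  have hd' : ((v i).1 : ℝ) * (v (i + 1)).2 - (v i).2 * (v (i + 1)).1 = 1 := by exact_mod_cast hd
  have hne : vecR (v j) ≠ 0 := by
    intro h
    have e1 := congrArg Prod.fst h
    have e2 := congrArg Prod.snd h
    simp [vecR] at e1 e2
    simp [e1, e2] at h1
  have e := (huni _ hne).unique (y₁ := i) (y₂ := j - 1)
    ⟨(((v j).1 * (v (i + 1)).2 - (v j).2 * (v (i + 1)).1 : ℤ) : ℝ),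
      (((v i).1 * (v j).2 - (v i).2 * (v j).1 : ℤ) : ℝ), by exact_mod_cast h1.le,
      by exact_mod_cast h2, by
        ext
        · simp [vecR]; linear_combination -(v j).1 * hd'
        · simp [vecR]; linear_combination -(v j).2 * hd'⟩
    ⟨0, 1, le_rfl, one_pos, by simp⟩
  subst e
  simp at h1
  linarith

lemma fan_vert {n : ℕ} {v : ZMod n → ℤ × ℤ} (hv : IsCompleteSmoothFan n v) {a : ZMod n → ℤ}
    (hf : ∀ i, (face n v a i).Nonempty) (i : ZMod n) :
    ∃ U : ℤ × ℤ, vecR U ∈ Pgon n v a ∧ dotR (vecR U) (vecR (v i)) = -(a i : ℝ) ∧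
      dotR (vecR U) (vecR (v (i + 1))) = -(a (i + 1) : ℝ) := by
  have hd := hv.2.1 i
  have hd' : ((v i).1 : ℝ) * (v (i + 1)).2 - (v i).2 * (v (i + 1)).1 = 1 := by exact_mod_cast hd
  refine ⟨(-(a i) * (v (i + 1)).2 + a (i + 1) * (v i).2,
    a i * (v (i + 1)).1 - a (i + 1) * (v i).1), ?_, ?_, ?_⟩
  · intro j
    obtain ⟨x, hx, hxi⟩ := hf i
    obtain ⟨y, hy, hyi⟩ := hf (i + 1)
    have hx1 := hx (i + 1)
    have hxj := hx j
    have hy1 := hy i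
    have hyj := hy j
    obtain ⟨α, hα⟩ : ∃ α : ℤ, α = (v j).1 * (v (i + 1)).2 - (v j).2 * (v (i + 1)).1 := ⟨_, rfl⟩
    obtain ⟨β, hβ⟩ : ∃ α : ℤ, α = (v i).1 * (v j).2 - (v i).2 * (v j).1 := ⟨_, rfl⟩
    have hα' : (α : ℝ) = (v j).1 * (v (i + 1)).2 - (v j).2 * (v (i + 1)).1 := by
      rw [hα]; push_cast; ring
    have hβ' : (β : ℝ) = (v i).1 * (v j).2 - (v i).2 * (v j).1 := by
      rw [hβ]; push_cast; ring
    have e : ∀ z : ℝ × ℝ, dotR z (vecR (v j)) =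
        α * dotR z (vecR (v i)) + β * dotR z (vecR (v (i + 1))) := by
      intro z
      rw [hα', hβ']; simp only [dotR, vecR]
      linear_combination (-(z.1 * (v j).1 + z.2 * (v j).2)) * hd'
    have eU : dotR (vecR (-(a i) * (v (i + 1)).2 + a (i + 1) * (v i).2,
        a i * (v (i + 1)).1 - a (i + 1) * (v i).1)) (vecR (v j)) =
        α * (-(a i : ℝ)) + β * (-(a (i + 1) : ℝ)) := by
      rw [hα', hβ']; simp only [dotR, vecR]; push_cast; ring
    rw [eU]
    rw [e, hxi] at hxj
    rw [e, hyi] at hyj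
    by_cases h1 : 0 < α
    · by_cases h2 : 0 < β
      · exact (fan_cone hv i j (hα ▸ h1) (hβ ▸ h2)).elim
      · have : (β : ℝ) ≤ 0 := by exact_mod_cast not_lt.1 h2
        have := mul_le_mul_of_nonpos_left hx1 this
        linarith
    · have : (α : ℝ) ≤ 0 := by exact_mod_cast not_lt.1 h1
      have := mul_le_mul_of_nonpos_left hy1 this
      linarith
  · simp only [dotR, vecR]; push_cast; linear_combination -(a i : ℝ) * hd'
  · simp only [dotR, vecR]; push_cast; linear_combination -(a (i + 1) : ℝ) * hd'

lemma fan_min {n : ℕ} {v : ZMod n → ℤ × ℤ} (hv : IsCompleteSmoothFan n v) {a : ZMod n → ℤ}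
    (hf : ∀ i, (face n v a i).Nonempty) (ξ : ℝ × ℝ) :
    ∃ u ∈ Pgon n v a ∩ latticeR2, ∀ s ∈ Pgon n v a, dotR u ξ ≤ dotR s ξ := by
  by_cases h0 : ξ = 0
  · obtain ⟨U, hU, -⟩ := fan_vert hv hf 0
    exact ⟨vecR U, ⟨hU, ⟨U, rfl⟩⟩, by simp [h0, dotR]⟩
  obtain ⟨i, ⟨s, t, hs, ht, rfl⟩, -⟩ := hv.2.2 ξ h0
  obtain ⟨U, hU, h1, h2⟩ := fan_vert hv hf i
  refine ⟨vecR U, ⟨hU, ⟨U, rfl⟩⟩, fun p hp => ?_⟩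
  have e : ∀ z : ℝ × ℝ, dotR z (s • vecR (v i) + t • vecR (v (i + 1))) =
      s * dotR z (vecR (v i)) + t * dotR z (vecR (v (i + 1))) := by
    intro z; simp [dotR]; ring
  rw [e, e, h1, h2]
  have i1 := mul_le_mul_of_nonneg_left (hp i) hs
  have i2 := mul_le_mul_of_nonneg_left (hp (i + 1)) ht.le
  linarith

lemma fan_pos {n : ℕ} {v : ZMod n → ℤ × ℤ} (hv : IsCompleteSmoothFan n v) (D : ℝ × ℝ)
    (hD : D ≠ 0) : ∃ j, 0 < dotR D (vecR (v j)) := by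
  by_contra! hcon
  obtain ⟨i, ⟨s, t, hs, ht, h⟩, -⟩ := hv.2.2 D hD
  have e : dotR D D = s * dotR D (vecR (v i)) + t * dotR D (vecR (v (i + 1))) := by
    conv_lhs => arg 2; rw [h]
    simp [dotR]; ring
  have i1 := mul_nonneg hs (by linarith [hcon i] : 0 ≤ - dotR D (vecR (v i)))
  have i2 := mul_nonneg ht.le (by linarith [hcon (i + 1)] : 0 ≤ - dotR D (vecR (v (i + 1))))
  have e2 : D.1 * D.1 + D.2 * D.2 ≤ 0 := by
    have : dotR D D = D.1 * D.1 + D.2 * D.2 := rfl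
    linarith
  apply hD
  ext
  · simp; nlinarith [mul_self_nonneg D.1, mul_self_nonneg D.2]
  · simp; nlinarith [mul_self_nonneg D.1, mul_self_nonneg D.2]

lemma pgon_eq (n : ℕ) (v : ZMod n → ℤ × ℤ) (a : ZMod n → ℤ) :
    Pgon n v a = {u | ∀ i, dotR u (vecR (-(v i))) ≤ (a i : ℝ)} := by
  ext u
  refine forall_congr' fun i => ?_
  have : dotR u (vecR (-(v i))) = - dotR u (vecR (v i)) := by simp [dotR, vecR]; ring
  rw [this]
  constructor <;> intro h <;> linarith

lemma pgon_convex (n : ℕ) (v : ZMod n → ℤ × ℤ) (a : ZMod n → ℤ) : Convex ℝ (Pgon n v a) := by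
  rw [pgon_eq]; exact convex_half (fun i => -(v i)) _

lemma pgon_closed (n : ℕ) (v : ZMod n → ℤ × ℤ) (a : ZMod n → ℤ) : IsClosed (Pgon n v a) := by
  have : Pgon n v a = ⋂ i, {u | -(a i : ℝ) ≤ dotR u (vecR (v i))} := by
    ext u; simp [Pgon]
  rw [this]
  refine isClosed_iInter fun i => isClosed_le continuous_const ?_
  unfold dotR; fun_prop

lemma fan_base {n : ℕ} {v : ZMod n → ℤ × ℤ} (hv : IsCompleteSmoothFan n v) {a : ZMod n → ℤ}
    (ha : IsAmplePgon n v a) (j : ZMod n) :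
    ∃ b ∈ Pgon n v a, b + vecR (-(v j).2, (v j).1) ∈ Pgon n v a ∧
      dotR b (vecR (v j)) = -(a j : ℝ) := by
  have hf : ∀ i, (face n v a i).Nonempty := fun i => by
    obtain ⟨x, hx, -⟩ := ha i; exact ⟨x, hx⟩
  obtain ⟨U, hU, hU0, hU1⟩ := fan_vert hv hf j
  obtain ⟨W, hW, hW0, hW1⟩ := fan_vert hv hf (j - 1)
  have d1 := hv.2.1 j
  have d0 := hv.2.1 (j - 1)
  rw [sub_add_cancel] at hW1 d0
  have d1' : ((v j).1 : ℝ) * (v (j + 1)).2 - (v j).2 * (v (j + 1)).1 = 1 := by exact_mod_cast d1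
  have d0' : ((v (j - 1)).1 : ℝ) * (v j).2 - (v (j - 1)).2 * (v j).1 = 1 := by exact_mod_cast d0
  refine ⟨vecR U, hU, ?_, hU0⟩
  have hcop := hv.1 j
  have dsub : ∀ x y z : ℝ × ℝ, dotR (x - y) z = dotR x z - dotR y z := by
    intro x y z; simp [dotR]; ring
  have dsm : ∀ (k : ℝ) (y z : ℝ × ℝ), dotR (k • y) z = k * dotR y z := by
    intro x y z; simp [dotR]; ring
  have E1 : dotR (vecR (-(v j).2, (v j).1)) (vecR (v (j + 1))) = 1 := by
    simp [dotR, vecR]; linarith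
  have E0 : dotR (vecR (-(v j).2, (v j).1)) (vecR (v (j - 1))) = -1 := by
    simp [dotR, vecR]; linarith
  obtain ⟨k, hk⟩ := latt_perp (v j) hcop (x := vecR W - vecR U) (latt_sub ⟨W, rfl⟩ ⟨U, rfl⟩) (by
    rw [dsub, hW1, hU0]; ring)
  have key : ∀ x ∈ face n v a j, ∃ τ : ℝ, x = vecR U + τ • vecR (-(v j).2, (v j).1) ∧
      0 ≤ τ ∧ τ ≤ k := by
    rintro x ⟨hx, hxj⟩
    obtain ⟨τ, hτ⟩ := real_perp (v j) hcop (x := x - vecR U) (by rw [dsub, hxj, hU0]; ring)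
    refine ⟨τ, by rw [← hτ]; abel, ?_, ?_⟩
    · have := congrArg (fun z => dotR z (vecR (v (j + 1)))) hτ
      simp only [dsub, dsm, E1, hU1] at this
      linarith [hx (j + 1)]
    · have t1 := congrArg (fun z => dotR z (vecR (v (j - 1)))) hτ
      have t2 := congrArg (fun z => dotR z (vecR (v (j - 1)))) hk
      simp only [dsub, dsm, E0, hW0] at t1 t2
      linarith [hx (j - 1)]
  obtain ⟨x, hx, y, hy, hxy⟩ := ha j
  obtain ⟨s, hs, s0, sk⟩ := key x hx
  obtain ⟨t, ht, t0, tk⟩ := key y hy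
  have hk1 : 1 ≤ k := by
    by_contra! h
    have : (k : ℝ) ≤ 0 := by exact_mod_cast (by omega : k ≤ 0)
    have e1 : s = 0 := by linarith
    have e2 : t = 0 := by linarith
    apply hxy
    rw [hs, ht, e1, e2]
  have hk1' : (1 : ℝ) ≤ k := by exact_mod_cast hk1
  have hk0 : (k : ℝ) ≠ 0 := by linarith
  have hWU : vecR W = vecR U + (k : ℝ) • vecR (-(v j).2, (v j).1) := by rw [← hk]; abel
  refine mem_comb2 (pgon_convex n v a) hU hW (1 - 1 / k) (1 / k) ?_ (by positivity) (by ring) ?_ ?_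
  · rw [sub_nonneg, div_le_one (by linarith)]; exact hk1'
  · rw [hWU]; simp; field_simp; ring
  · rw [hWU]; simp; field_simp; ring

end Fan

/-- **Theorem 1 (combinatorial form).** If `P(a)` is ample and `P(b)` is
globally generated, then every lattice point of the Minkowski sum
`P(a) + P(b)` is the sum of a lattice point of `P(a)` and a lattice point of
`P(b)`. -/
theorem thm_sections_combinatorial (n : ℕ) (hn : 3 ≤ n) (v : ZMod n → ℤ × ℤ)
    (hv : IsCompleteSmoothFan n v) (a b : ZMod n → ℤ)
    (ha : IsAmplePgon n v a) (hb : IsGGPgon n v b) :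
    (Pgon n v a ∩ latticeR2) + (Pgon n v b ∩ latticeR2) =
      (Pgon n v a + Pgon n v b) ∩ latticeR2 := by
  haveI : NeZero n := ⟨by omega⟩
  have hfa : ∀ i, (face n v a i).Nonempty := fun i => by
    obtain ⟨x, hx, -⟩ := ha i; exact ⟨x, hx⟩
  have hfb := hb.2.1
  apply Set.Subset.antisymm
  · rintro _ ⟨x, ⟨hx, hxL⟩, y, ⟨hy, hyL⟩, rfl⟩
    exact ⟨⟨x, hx, y, hy, rfl⟩, latt_add hxL hyL⟩
  · rintro w ⟨⟨x, hx, y, hy, hxy⟩, hwL⟩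
    simp only at hxy
    have hQm : ∀ u, u ∈ {u | ∀ i, dotR u (vecR (v i)) ≤ dotR w (vecR (v i)) + b i} ↔
        w - u ∈ Pgon n v b := by
      intro u
      refine forall_congr' fun i => ?_
      have : dotR (w - u) (vecR (v i)) = dotR w (vecR (v i)) - dotR u (vecR (v i)) := by
        simp [dotR]; ring
      rw [this]
      constructor <;> intro h <;> linarith
    have hmin : ∀ ξ : ℝ × ℝ,
        ∃ u ∈ {u | ∀ i, dotR u (vecR (v i)) ≤ dotR w (vecR (v i)) + b i} ∩ latticeR2,
        ∀ s ∈ {u | ∀ i, dotR u (vecR (v i)) ≤ dotR w (vecR (v i)) + b i},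
          dotR u ξ ≤ dotR s ξ := by
      intro ξ
      obtain ⟨u, ⟨hu, huL⟩, h⟩ := fan_min hv hfb (-ξ)
      refine ⟨w - u, ⟨(hQm _).2 (by simpa using hu), latt_sub hwL huL⟩, fun s hs => ?_⟩
      have := h (w - s) ((hQm s).1 hs)
      simp [dotR] at this ⊢
      linarith
    have hxQ : x ∈ {u | ∀ i, dotR u (vecR (v i)) ≤ dotR w (vecR (v i)) + b i} := by
      rw [hQm, ← hxy]; simpa using hy
    obtain ⟨u, huL, huP, huQ⟩ := core v (fun i => dotR w (vecR (v i)) + b i) (Pgon n v a) _ rfl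
      hv.1 (fan_pos hv) (pgon_convex n v a) (pgon_closed n v a) (hull_of_min (fan_min hv hfa))
      (hull_of_min hmin) (fin_of_min hmin) (by
        intro j
        obtain ⟨b', h1, h2, h3⟩ := fan_base hv ha j
        refine ⟨b', h1, h2, ?_⟩
        rw [h3]
        exact (hx j).trans (hxQ j)) hx hxQ
    exact ⟨u, ⟨huP, huL⟩, w - u, ⟨(hQm u).1 huQ, latt_sub hwL huL⟩, by simp⟩
end

section
/- Theorem 2 (combinatorial form). Let a ∈ ℤⁿ be such that P(a) is ample. Then there exists a constant C, depending only on v_1, …, v_n and a, such that for every b ∈ ℤⁿ with P(b) ∩ ℤ² ≠ ∅, the set (P(a+b) ∩ ℤ²) \ ((P(a) ∩ ℤ²) + (P(b) ∩ ℤ²)) has at most C elements, where (P(a) ∩ ℤ²) + (P(b) ∩ ℤ²) denotes the set of all sums of a lattice point of P(a) and a lattice point of P(b). (This is the combinatorial form of: for an ample line bundle L on a smooth projective toric surface X there is a constant C(L) such that for every line bundle M with H⁰(X,M) ≠ 0 the cokernel of H⁰(X,L) ⊗ H⁰(X,M) → H⁰(X, L⊗M) has dimension at most C(L).) -/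
open scoped Pointwise

def dotZ (u w : ℤ × ℤ) : ℤ := u.1 * w.1 + u.2 * w.2

def detZ (u w : ℤ × ℤ) : ℤ := u.1 * w.2 - u.2 * w.1

theorem dotR_vecR (u w : ℤ × ℤ) : dotR (vecR u) (vecR w) = (dotZ u w : ℝ) := by
  simp [dotR, vecR, dotZ]

theorem mem_Pgon_int {n : ℕ} {v : ZMod n → ℤ × ℤ} {a : ZMod n → ℤ} {w : ℤ × ℤ} :
    vecR w ∈ Pgon n v a ↔ ∀ i, -a i ≤ dotZ w (v i) := by
  simp only [Pgon, Set.mem_ofPred_eq, dotR_vecR]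
  exact forall_congr' fun i => by exact_mod_cast Iff.rfl

theorem decompZ {n : ℕ} {v : ZMod n → ℤ × ℤ} (hv : IsCompleteSmoothFan n v) (i k : ZMod n) :
    v k = (detZ (v k) (v (i + 1)) * (v i).1 + detZ (v i) (v k) * (v (i + 1)).1,
      detZ (v k) (v (i + 1)) * (v i).2 + detZ (v i) (v k) * (v (i + 1)).2) := by
  have h := hv.2.1 i
  simp only [detZ]
  ext
  · simp only; linear_combination (-(v k).1) * h
  · simp only; linear_combination (-(v k).2) * h

theorem vecR_ne {n : ℕ} {v : ZMod n → ℤ × ℤ} (hv : IsCompleteSmoothFan n v) (k : ZMod n) :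
    vecR (v k) ≠ 0 := by
  intro h
  have h1 : (v k).1 = 0 := by
    have := congrArg Prod.fst h
    simpa [vecR] using this
  have h2 : (v k).2 = 0 := by
    have := congrArg Prod.snd h
    simpa [vecR] using this
  have := hv.1 k
  rw [h1, h2] at this
  obtain ⟨x, y, hxy⟩ := this
  simp at hxy

/-- a ray in the half-open cone `(i, i+1]` is `i+1` -/
theorem cone_eq {n : ℕ} {v : ZMod n → ℤ × ℤ} (hv : IsCompleteSmoothFan n v) (i k : ZMod n)
    (hs : 0 ≤ detZ (v k) (v (i + 1))) (ht : 0 < detZ (v i) (v k)) : k = i + 1 := by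
  obtain ⟨j, _, hj⟩ := hv.2.2 (vecR (v k)) (vecR_ne hv k)
  have e1 := hj (k - 1) ⟨0, 1, le_refl _, one_pos, by simp⟩
  have e2 := hj i ⟨detZ (v k) (v (i + 1)), detZ (v i) (v k), by exact_mod_cast hs,
    by exact_mod_cast ht, by
      have := decompZ hv i k
      have h1 := congrArg Prod.fst this
      have h2 := congrArg Prod.snd this
      refine Prod.ext ?_ ?_
      · simp only [vecR, Prod.fst_add, Prod.smul_fst, smul_eq_mul]; exact_mod_cast h1
      · simp only [vecR, Prod.snd_add, Prod.smul_snd, smul_eq_mul]; exact_mod_cast h2⟩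
  rw [e2, ← e1]; ring

/-- dependent rays are equal or opposite -/
theorem dep {n : ℕ} {v : ZMod n → ℤ × ℤ} (hv : IsCompleteSmoothFan n v) (j k : ZMod n)
    (h : detZ (v j) (v k) = 0) : k = j ∨ v k = -v j := by
  have hd := decompZ hv j k
  rw [h] at hd
  set s := detZ (v k) (v (j + 1)) with hs
  have h1 : (v k).1 = s * (v j).1 := by rw [hd]; simp
  have h2 : (v k).2 = s * (v j).2 := by rw [hd]; simp
  have hc := hv.1 k
  have hu : IsUnit s := by
    obtain ⟨x, y, hxy⟩ := hc
    rw [h1, h2] at hxy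
    exact IsUnit.of_mul_eq_one (x * (v j).1 + y * (v j).2) (by linear_combination hxy)
  rcases Int.isUnit_iff.1 hu with e | e
  · left
    have hvk : v k = v j := by ext <;> simp [h1, h2, e]
    have hh := hv.2.1 (j - 1)
    have e1 : j - 1 + 1 = j := by ring
    have := cone_eq hv (j - 1) k (by rw [hvk, e1]; simp [detZ, mul_comm])
      (by rw [hvk]; simp only [detZ]; rw [e1] at hh; omega)
    rw [this, e1]
  · right
    ext <;> simp [h1, h2, e]

/-- the vertex -/
def vtx {n : ℕ} (v : ZMod n → ℤ × ℤ) (a : ZMod n → ℤ) (i : ZMod n) : ℤ × ℤ :=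
  (-a i * (v (i + 1)).2 + a (i + 1) * (v i).2, a i * (v (i + 1)).1 - a (i + 1) * (v i).1)

theorem vtx_dot {n : ℕ} {v : ZMod n → ℤ × ℤ} (hv : IsCompleteSmoothFan n v)
    (a : ZMod n → ℤ) (i : ZMod n) :
    dotZ (vtx v a i) (v i) = -a i ∧ dotZ (vtx v a i) (v (i + 1)) = -a (i + 1) := by
  have h := hv.2.1 i
  simp only [dotZ, vtx]
  constructor
  · linear_combination (-a i) * h
  · linear_combination (-a (i + 1)) * h

theorem dotR_decomp {n : ℕ} {v : ZMod n → ℤ × ℤ} (hv : IsCompleteSmoothFan n v)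
    (i k : ZMod n) (y : ℝ × ℝ) :
    dotR y (vecR (v k)) = (detZ (v k) (v (i + 1)) : ℝ) * dotR y (vecR (v i)) +
      (detZ (v i) (v k) : ℝ) * dotR y (vecR (v (i + 1))) := by
  have := decompZ hv i k
  have h1 := congrArg (fun z : ℤ × ℤ => (z.1 : ℝ)) this
  have h2 := congrArg (fun z : ℤ × ℤ => (z.2 : ℝ)) this
  simp only [Int.cast_add, Int.cast_mul] at h1 h2
  simp only [dotR, vecR]
  rw [h1, h2]; ring

theorem vtx_mem {n : ℕ} {v : ZMod n → ℤ × ℤ} (hv : IsCompleteSmoothFan n v)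
    {a : ZMod n → ℤ} (ha : IsAmplePgon n v a) (i : ZMod n) :
    vecR (vtx v a i) ∈ Pgon n v a := by
  intro k
  obtain ⟨h1, h2⟩ := vtx_dot hv a i
  rw [dotR_decomp hv i k, dotR_vecR, dotR_vecR, h1, h2]
  obtain ⟨x, ⟨hxP, hx⟩, -⟩ := ha i
  obtain ⟨y, ⟨hyP, hy⟩, -⟩ := ha (i + 1)
  have hxk := hxP k
  have hyk := hyP k
  have hx1 := hxP (i + 1)
  have hyi := hyP i
  rw [dotR_decomp hv i k, hx] at hxk
  rw [dotR_decomp hv i k, hy] at hyk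
  push_cast
  rcases le_or_gt (detZ (v i) (v k)) 0 with ht | ht
  · have ht' : (detZ (v i) (v k) : ℝ) ≤ 0 := by exact_mod_cast ht
    nlinarith [mul_le_mul_of_nonpos_left hx1 ht']
  · rcases lt_or_ge (detZ (v k) (v (i + 1))) 0 with hs | hs
    · have hs' : (detZ (v k) (v (i + 1)) : ℝ) ≤ 0 := by exact_mod_cast hs.le
      nlinarith [mul_le_mul_of_nonpos_left hyi hs']
    · have := cone_eq hv i k hs ht
      subst this
      have := hv.2.1 i
      have e1 : detZ (v (i + 1)) (v (i + 1)) = 0 := by simp [detZ, mul_comm]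
      have e2 : detZ (v i) (v (i + 1)) = 1 := this
      rw [e1, e2]; simp

theorem Pgon_conv {n : ℕ} {v : ZMod n → ℤ × ℤ} {a : ZMod n → ℤ} : Convex ℝ (Pgon n v a) := by
  intro x hx y hy s t hs ht hst k
  have h1 := mul_le_mul_of_nonneg_left (hx k) hs
  have h2 := mul_le_mul_of_nonneg_left (hy k) ht
  have : dotR (s • x + t • y) (vecR (v k)) =
    s * dotR x (vecR (v k)) + t * dotR y (vecR (v k)) := by
    simp [dotR]; ring
  rw [this]
  have e : -(a k : ℝ) = s * -(a k : ℝ) + t * -(a k : ℝ) := by rw [← add_mul, hst, one_mul]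
  linarith

theorem Pgon_comb {n : ℕ} {v : ZMod n → ℤ × ℤ} {a : ZMod n → ℤ} {x y : ℝ × ℝ}
    (hx : x ∈ Pgon n v a) (hy : y ∈ Pgon n v a) (τ : ℝ) (h0 : 0 ≤ τ) (h1 : τ ≤ 1) :
    (1 - τ) • x + τ • y ∈ Pgon n v a :=
  Pgon_conv hx hy (by linarith) h0 (by ring)

def perp (w : ℤ × ℤ) : ℤ × ℤ := (w.2, -w.1)

/-- each face has two consecutive lattice points -/
theorem face_two {n : ℕ} {v : ZMod n → ℤ × ℤ} (hv : IsCompleteSmoothFan n v)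
    {a : ZMod n → ℤ} (ha : IsAmplePgon n v a) (i : ZMod n) :
    ∃ w : ℤ × ℤ, vecR w ∈ Pgon n v a ∧ vecR (w + perp (v i)) ∈ Pgon n v a ∧
      dotZ w (v i) = -a i := by
  obtain ⟨i, rfl⟩ : ∃ j, i = j + 1 := ⟨i - 1, by ring⟩
  have hp := vtx_mem hv ha i
  have hq := vtx_mem hv ha (i + 1)
  obtain ⟨hp1, hp2⟩ := vtx_dot hv a i
  obtain ⟨hq1, hq2⟩ := vtx_dot hv a (i + 1)
  generalize vtx v a i = p at *
  generalize vtx v a (i + 1) = q at *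
  obtain ⟨d, hd⟩ : ∃ d, d = perp (v (i + 1)) := ⟨_, rfl⟩
  rw [← hd]
  have D1 := hv.2.1 i
  have D2 := hv.2.1 (i + 1)
  -- q = p + L d
  obtain ⟨L, hL⟩ : ∃ L : ℤ, L = dotZ q (v i) + a i := ⟨_, rfl⟩
  have hqp1 : q.1 = p.1 + L * d.1 := by
    rw [hL, hd]; simp only [perp, dotZ] at hp1 hp2 hq1 ⊢
    linear_combination (-q.1 + p.1) * D1 - (v (i+1)).2 * hp1 + (v i).2 * hp2 - (v i).2 * hq1
  have hqp2 : q.2 = p.2 + L * d.2 := by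
    rw [hL, hd]; simp only [perp, dotZ] at hp1 hp2 hq1 ⊢
    linear_combination (-q.2 + p.2) * D1 + (v (i+1)).1 * hp1 - (v i).1 * hp2 + (v i).1 * hq1
  have hLpos : 0 < L := by
    obtain ⟨x, ⟨hxP, hx⟩, y, ⟨hyP, hy⟩, hxy⟩ := ha (i + 1)
    by_contra hneg
    apply hxy
    have key : ∀ z ∈ Pgon n v a, dotR z (vecR (v (i+1))) = -(a (i+1) : ℝ) →
        dotR z (vecR (v i)) = -(a i : ℝ) := by
      intro z hz hze
      have z1 := hz i
      have z2 := hz (i + 1 + 1)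
      have hneg' : (L : ℝ) ≤ 0 := by exact_mod_cast not_lt.1 hneg
      have e2 := dotR_decomp hv i (i + 1 + 1) z
      have e3 := dotR_decomp hv i (i + 1 + 1) (vecR q)
      have e4 : detZ (v (i+1+1)) (v (i+1)) = -1 := by
        simp only [detZ]; linarith
      rw [e4, hze] at e2
      rw [e4, dotR_vecR, dotR_vecR, dotR_vecR, hq1, hq2] at e3
      have hL' : (L : ℝ) = dotZ q (v i) + a i := by rw [hL]; push_cast; ring
      push_cast at e2 e3
      linarith
    have kx := key x hxP hx
    have ky := key y hyP hy
    have D1' : ((v i).1 : ℝ) * (v (i+1)).2 - (v i).2 * (v (i+1)).1 = 1 := by exact_mod_cast D1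
    simp only [dotR, vecR] at hx hy kx ky
    ext
    · linear_combination (-x.1 + y.1) * D1' + ((v (i+1)).2 : ℝ) * (kx - ky) - ((v i).2 : ℝ) * (hx - hy)
    · linear_combination (-x.2 + y.2) * D1' - ((v (i+1)).1 : ℝ) * (kx - ky) + ((v i).1 : ℝ) * (hx - hy)
  refine ⟨p, hp, ?_, hp2⟩
  have hL1 : (1 : ℝ) ≤ L := by exact_mod_cast hLpos
  have hL0 : (L : ℝ) ≠ 0 := by positivity
  have := Pgon_comb hp hq (1 / (L : ℝ)) (by positivity)
    (by rw [div_le_one (by positivity)]; exact hL1)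
  convert this using 1
  ext
  · simp only [vecR, Prod.fst_add, Prod.smul_fst, smul_eq_mul, hqp1]
    push_cast; field_simp; ring
  · simp only [vecR, Prod.snd_add, Prod.smul_snd, smul_eq_mul, hqp2]
    push_cast; field_simp; ring

/-- slices contain lattice points -/
theorem slice {n : ℕ} {v : ZMod n → ℤ × ℤ} (hv : IsCompleteSmoothFan n v)
    {a : ZMod n → ℤ} (ha : IsAmplePgon n v a) (j k : ZMod n) (hjk : v k = -v j)
    (t : ℤ) (ht0 : 0 ≤ t) (ht1 : t ≤ a j + a k) :
    ∃ w : ℤ × ℤ, vecR w ∈ Pgon n v a ∧ dotZ w (v j) = -a j + t := by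
  obtain ⟨w, hw, hw', hwe⟩ := face_two hv ha j
  obtain ⟨z', hz', hz, hze'⟩ := face_two hv ha k
  obtain ⟨z, rfl⟩ : ∃ z, z' = z + perp (v j) := ⟨z' - perp (v j), by simp⟩
  have hzz : z + perp (v j) + perp (v k) = z := by
    rw [hjk]; ext <;> simp [perp]
  rw [hzz] at hz
  set d := perp (v j) with hd
  have hze : dotZ z (v j) = a k := by
    rw [hjk] at hze'
    simp only [dotZ, hd, perp, Prod.fst_add, Prod.snd_add, Prod.fst_neg, Prod.snd_neg] at hze' ⊢
    linarith
  rcases eq_or_lt_of_le ht0 with rfl | htpos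
  · exact ⟨w, hw, by simpa using hwe⟩
  have hA : (0 : ℝ) < a j + a k := by exact_mod_cast lt_of_lt_of_le htpos ht1
  obtain ⟨τ, hτ⟩ : ∃ τ : ℝ, τ = t / (a j + a k) := ⟨_, rfl⟩
  have hτ0 : 0 ≤ τ := by rw [hτ]; have : (0 : ℝ) ≤ t := by exact_mod_cast ht0
                         positivity
  have hτ1 : τ ≤ 1 := by rw [hτ, div_le_one hA]; exact_mod_cast ht1
  have hτA : τ * (a j + a k) = t := by rw [hτ]; field_simp
  have hP := Pgon_comb hw hz τ hτ0 hτ1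
  have hP' := Pgon_comb hw' hz' τ hτ0 hτ1
  -- g = w + t * c
  have D := hv.2.1 j
  obtain ⟨c, hc⟩ : ∃ c : ℤ × ℤ, c = perp (v (j + 1)) := ⟨_, rfl⟩
  -- r: p = g + r d ; r = - <p - g, v (j+1)>
  obtain ⟨r, hr⟩ : ∃ r : ℝ, r = -(τ * (dotZ (z - w) (v (j + 1)) : ℝ)) := ⟨_, rfl⟩
  have hwe' : (w.1 : ℝ) * (v j).1 + w.2 * (v j).2 = -a j := by
    have := hwe; simp only [dotZ] at this; exact_mod_cast this
  have hze'' : (z.1 : ℝ) * (v j).1 + z.2 * (v j).2 = a k := by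
    have := hze; simp only [dotZ] at this; exact_mod_cast this
  have D' : ((v j).1 : ℝ) * (v (j+1)).2 - (v j).2 * (v (j+1)).1 = 1 := by exact_mod_cast D
  have hdiff1 : τ * ((z.1 : ℝ) - w.1) = t * c.1 + r * d.1 := by
    rw [hr, hc, hd, ← hτA]; simp only [perp, dotZ, Prod.fst_sub, Prod.snd_sub]; push_cast
    linear_combination (-τ * ((z.1 : ℝ) - w.1)) * D' + τ * ((v (j+1)).2 : ℝ) * (hze'' - hwe')
  have hdiff2 : τ * ((z.2 : ℝ) - w.2) = t * c.2 + r * d.2 := by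
    rw [hr, hc, hd, ← hτA]; simp only [perp, dotZ, Prod.fst_sub, Prod.snd_sub]; push_cast
    linear_combination (-τ * ((z.2 : ℝ) - w.2)) * D' - τ * ((v (j+1)).1 : ℝ) * (hze'' - hwe')
  have hc1 := Int.le_ceil r
  have hc2 := (Int.ceil_lt_add_one r).le
  have hfin := Pgon_comb hP hP' (⌈r⌉ - r) (by linarith) (by linarith)
  refine ⟨(w.1 + t * c.1 + ⌈r⌉ * d.1, w.2 + t * c.2 + ⌈r⌉ * d.2), ?_, ?_⟩
  · convert hfin using 1
    ext
    · simp only [vecR, Prod.fst_add, Prod.smul_fst, smul_eq_mul]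
      push_cast
      linear_combination -hdiff1
    · simp only [vecR, Prod.snd_add, Prod.smul_snd, smul_eq_mul]
      push_cast
      linear_combination -hdiff2
  · rw [hc, hd]; simp only [dotZ, perp] at hwe ⊢
    linear_combination hwe + t * D

theorem bounded {n : ℕ} {v : ZMod n → ℤ × ℤ} (hv : IsCompleteSmoothFan n v)
    (a : ZMod n → ℤ) (i : ZMod n) :
    ∃ B : ℤ, ∀ w : ℤ × ℤ, vecR w ∈ Pgon n v a → dotZ w (v i) + a i ≤ B := by
  obtain ⟨j, ⟨s, t, hs, ht, h⟩, -⟩ := hv.2.2 (-vecR (v i)) (neg_ne_zero.2 (vecR_ne hv i))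
  refine ⟨⌈s * a j + t * a (j + 1)⌉ + a i, fun w hw => ?_⟩
  have h1 := mul_le_mul_of_nonneg_left (hw j) hs
  have h2 := mul_le_mul_of_nonneg_left (hw (j + 1)) ht.le
  have e : dotR (vecR w) (-vecR (v i)) = s * dotR (vecR w) (vecR (v j)) +
      t * dotR (vecR w) (vecR (v (j + 1))) := by
    rw [h]; simp [dotR]; ring
  have e' : dotR (vecR w) (-vecR (v i)) = -(dotZ w (v i) : ℝ) := by
    rw [← dotR_vecR]; simp [dotR]; ring
  have : (dotZ w (v i) : ℝ) ≤ ⌈s * a j + t * a (j + 1)⌉ := by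
    have := Int.le_ceil (s * a j + t * a (j + 1))
    linarith
  have : dotZ w (v i) ≤ ⌈s * a j + t * a (j + 1)⌉ := by exact_mod_cast this
  linarith

theorem dichotomy (n : ℕ) (hn : 3 ≤ n) (v : ZMod n → ℤ × ℤ)
    (hv : IsCompleteSmoothFan n v) (a : ZMod n → ℤ) (ha : IsAmplePgon n v a) :
    ∃ K : ℤ, ∀ b : ZMod n → ℤ, (Pgon n v b ∩ latticeR2).Nonempty →
      ∀ u : ℤ × ℤ, vecR u ∈ Pgon n v (a + b) →
      (∃ w : ℤ × ℤ, vecR w ∈ Pgon n v a ∧ vecR (u - w) ∈ Pgon n v b) ∨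
      ∃ j k, detZ (v j) (v k) ≠ 0 ∧ dotZ u (v j) + (a j + b j) < K ∧
        dotZ u (v k) + (a k + b k) < K := by
  haveI : NeZero n := ⟨by omega⟩
  choose B hB using bounded hv a
  obtain ⟨K, hK⟩ := (Set.finite_range B).bddAbove
  have hBK : ∀ w, vecR w ∈ Pgon n v a → ∀ i, dotZ w (v i) + a i ≤ K := fun w hw i =>
    (hB i w hw).trans (hK ⟨i, rfl⟩)
  refine ⟨K, fun b hb u hu => ?_⟩
  rw [or_iff_not_imp_right]
  intro hno
  push Not at hno
  rw [mem_Pgon_int] at hu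
  have good : ∀ w : ℤ × ℤ, vecR w ∈ Pgon n v a →
      (∀ i, dotZ u (v i) + (a i + b i) < K →
        dotZ w (v i) + a i ≤ dotZ u (v i) + (a i + b i)) →
      ∃ w : ℤ × ℤ, vecR w ∈ Pgon n v a ∧ vecR (u - w) ∈ Pgon n v b := by
    intro w hw h
    refine ⟨w, hw, mem_Pgon_int.2 fun i => ?_⟩
    have e : dotZ (u - w) (v i) = dotZ u (v i) - dotZ w (v i) := by simp [dotZ]; ring
    rw [e]
    have := hBK w hw i
    rcases lt_or_ge (dotZ u (v i) + (a i + b i)) K with h1 | h1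
    · have := h i h1
      linarith
    · linarith
  by_cases hJ : ∃ j, dotZ u (v j) + (a j + b j) < K
  swap
  · push Not at hJ
    exact good _ (vtx_mem hv ha 0) fun i hi => absurd hi (not_lt.2 (hJ i))
  obtain ⟨j, hj⟩ := hJ
  have hdep : ∀ l, dotZ u (v l) + (a l + b l) < K → l = j ∨ v l = -v j := by
    intro l hl
    refine dep hv j l ?_
    by_contra h
    exact absurd hl (not_lt.2 (hno j l h hj))
  have huj : 0 ≤ dotZ u (v j) + (a j + b j) := by have := hu j; simp at this; linarith
  by_cases hk : ∃ k, dotZ u (v k) + (a k + b k) < K ∧ v k = -v j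
  swap
  · push Not at hk
    refine good _ (vtx_mem hv ha j) fun i hi => ?_
    obtain rfl : i = j := (hdep i hi).resolve_right (hk i hi)
    rw [(vtx_dot hv a i).1]; linarith
  obtain ⟨k, hkK, hk⟩ := hk
  have hneg : ∀ x : ℤ × ℤ, dotZ x (v k) = -dotZ x (v j) := by
    intro x; rw [hk]; simp [dotZ]; ring
  have huk : 0 ≤ dotZ u (v k) + (a k + b k) := by have := hu k; simp at this; linarith
  have hbb : 0 ≤ b j + b k := by
    obtain ⟨x, hx, m, rfl⟩ := hb
    have hx := mem_Pgon_int.1 hx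
    have h1 := hx j
    have h2 := hx k
    rw [hneg] at h2
    linarith
  have haa : 0 ≤ a j + a k := by
    have hx := mem_Pgon_int.1 (vtx_mem hv ha j)
    have h1 := hx j
    have h2 := hx k
    rw [hneg] at h2
    linarith
  obtain ⟨w, hw, hwe⟩ := slice hv ha j k hk (min (dotZ u (v j) + (a j + b j)) (a j + a k))
    (le_min huj haa) (min_le_right _ _)
  refine good w hw fun i hi => ?_
  rcases hdep i hi with rfl | h
  · rw [hwe]
    have := min_le_left (dotZ u (v i) + (a i + b i)) (a i + a k)
    linarith
  · have : i = k := by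
      rcases dep hv k i (by rw [h, hk]; simp [detZ, mul_comm]) with h' | h'
      · exact h'
      · exfalso
        rw [hk, neg_neg] at h'
        rw [h'] at h
        have h1 := congrArg Prod.fst h
        have h2 := congrArg Prod.snd h
        simp only [Prod.fst_neg, Prod.snd_neg] at h1 h2
        have := hv.2.1 j
        have e1 : (v j).1 = 0 := by omega
        have e2 : (v j).2 = 0 := by omega
        rw [e1, e2] at this
        simp at this
    subst this
    rw [hneg, hwe]
    rw [hneg] at huk ⊢
    rcases min_cases (dotZ u (v j) + (a j + b j)) (a j + a i) with ⟨e, _⟩ | ⟨e, _⟩ <;> rw [e] <;>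
      linarith

/-- **Theorem 2 (combinatorial form).** If `P(a)` is ample, there is a
constant `C` (depending only on the fan and on `a`) such that for every
`b : ZMod n → ℤ` with `P(b)` containing a lattice point, the set of lattice
points of `P(a + b)` which are not sums of a lattice point of `P(a)` and a
lattice point of `P(b)` has at most `C` elements. -/
theorem thm_effective_combinatorial (n : ℕ) (hn : 3 ≤ n) (v : ZMod n → ℤ × ℤ)
    (hv : IsCompleteSmoothFan n v) (a : ZMod n → ℤ)
    (ha : IsAmplePgon n v a) :
    ∃ C : ℕ, ∀ b : ZMod n → ℤ, (Pgon n v b ∩ latticeR2).Nonempty →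
      ((Pgon n v (a + b) ∩ latticeR2) \
        ((Pgon n v a ∩ latticeR2) + (Pgon n v b ∩ latticeR2))).ncard ≤ C := by
  haveI : NeZero n := ⟨by omega⟩
  obtain ⟨K, hK⟩ := dichotomy n hn v hv a ha
  refine ⟨((Set.univ : Set (ZMod n)) ×ˢ (Set.univ : Set (ZMod n)) ×ˢ
    Set.Ico (0 : ℤ) K ×ˢ Set.Ico (0 : ℤ) K).ncard, fun b hb => ?_⟩
  have key : ∀ x : ℝ × ℝ, ∃ r : (ZMod n × ZMod n × ℤ × ℤ), x ∈ ((Pgon n v (a + b) ∩ latticeR2) \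
        ((Pgon n v a ∩ latticeR2) + (Pgon n v b ∩ latticeR2))) →
      ∃ u : ℤ × ℤ, x = vecR u ∧ detZ (v r.1) (v r.2.1) ≠ 0 ∧
        r.2.2.1 = dotZ u (v r.1) + (a r.1 + b r.1) ∧
        r.2.2.2 = dotZ u (v r.2.1) + (a r.2.1 + b r.2.1) ∧
        r.2.2.1 ∈ Set.Ico (0 : ℤ) K ∧ r.2.2.2 ∈ Set.Ico (0 : ℤ) K := by
    intro x
    by_cases hx : x ∈ ((Pgon n v (a + b) ∩ latticeR2) \
        ((Pgon n v a ∩ latticeR2) + (Pgon n v b ∩ latticeR2)))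
    swap
    · exact ⟨(0, 0, 0, 0), fun h => absurd h hx⟩
    obtain ⟨⟨hxP, u, rfl⟩, hbad⟩ := hx
    rcases hK b hb u hxP with ⟨w, hw, huw⟩ | ⟨j, k, hd, hj, hk⟩
    · exfalso
      apply hbad
      refine Set.mem_add.2 ⟨vecR w, ⟨hw, w, rfl⟩, vecR (u - w), ⟨huw, _, rfl⟩, ?_⟩
      ext <;> simp [vecR]
    · have hm := mem_Pgon_int.1 hxP
      have h1 := hm j
      have h2 := hm k
      simp only [Pi.add_apply] at h1 h2
      exact ⟨(j, k, dotZ u (v j) + (a j + b j), dotZ u (v k) + (a k + b k)), fun _ =>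
        ⟨u, rfl, hd, rfl, rfl, ⟨by linarith, hj⟩, ⟨by linarith, hk⟩⟩⟩
  choose f hf using key
  refine Set.ncard_le_ncard_of_injOn f ?_ ?_ ?_
  · intro x hx
    obtain ⟨u, -, -, -, -, h1, h2⟩ := hf x hx
    exact ⟨trivial, trivial, h1, h2⟩
  · intro x hx y hy hxy
    obtain ⟨u, rfl, hd, h1, h2, -⟩ := hf x hx
    obtain ⟨u', rfl, -, h1', h2', -⟩ := hf y hy
    rw [← hxy] at h1' h2'
    rw [h1] at h1'
    rw [h2] at h2'
    simp only [detZ, dotZ] at hd h1' h2'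
    have e1 : u.1 = u'.1 := by
      apply mul_left_cancel₀ hd
      linear_combination (v (f (vecR u)).2.1).2 * h1' - (v (f (vecR u)).1).2 * h2'
    have e2 : u.2 = u'.2 := by
      apply mul_left_cancel₀ hd
      linear_combination -(v (f (vecR u)).2.1).1 * h1' + (v (f (vecR u)).1).1 * h2'
    rw [Prod.ext e1 e2]
  · exact Set.finite_univ.prod (Set.finite_univ.prod
      ((Set.finite_Ico _ _).prod (Set.finite_Ico _ _)))
end

section
/- Lemma (bounded lattice length of the shrunken edges). There exists a constant C, depending only on v_1, …, v_n, with the following property. Let a ∈ ℤⁿ with a_i ≥ 0 for all i, let S = P(a) ∩ ℤ², for each i let b_i = min{c ∈ ℤ : ⟨s, v_i⟩ ≥ -c for all s ∈ S}, and let J = {i : b_i < a_i}. Then the total number of lattice points lying on the faces σ_j(b) = P(b) ∩ {u : ⟨u, v_j⟩ = -b_j} for j ∈ J, i.e. the cardinality of (⋃_{j ∈ J} σ_j(b)) ∩ ℤ², is at most C. -/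
open scoped Pointwise

/-- Integer dot product. -/
def dotZaux (m w : ℤ × ℤ) : ℤ := m.1 * w.1 + m.2 * w.2

theorem dotR_vecR_aux (m w : ℤ × ℤ) : dotR (vecR m) (vecR w) = ((dotZaux m w : ℤ) : ℝ) := by
  simp [dotR, vecR, dotZaux]

/-- two parallel rays of the fan coincide -/
theorem fan_inj_aux (n : ℕ) (v : ZMod n → ℤ × ℤ) (hv : IsCompleteSmoothFan n v)
    (i j : ZMod n) (c : ℤ) (hc : 0 < c) (h1 : (v i).1 = c * (v j).1)
    (h2 : (v i).2 = c * (v j).2) : i = j := by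
  obtain ⟨-, hdet, huniq⟩ := hv
  have hne : vecR (v i) ≠ 0 := by
    intro h
    have h3 : ((v i).1 : ℝ) = 0 := congrArg Prod.fst h
    have h4 : ((v i).2 : ℝ) = 0 := congrArg Prod.snd h
    have h3' : (v i).1 = 0 := by exact_mod_cast h3
    have h4' : (v i).2 = 0 := by exact_mod_cast h4
    have := hdet i
    rw [h3', h4'] at this
    simp at this
  have := (huniq _ hne).unique (y₁ := i - 1) (y₂ := j - 1)
    ⟨0, 1, le_refl _, one_pos, by simp⟩
    ⟨0, (c : ℝ), le_refl _, by exact_mod_cast hc, by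
      simp only [sub_add_cancel]
      ext <;> simp [vecR, h1, h2]⟩
  exact sub_left_injective this

theorem core_aux (n : ℕ) (v : ZMod n → ℤ × ℤ) (hv : IsCompleteSmoothFan n v)
    (M : ℤ) (j : ZMod n)
    (hM : ∀ i, |(v (j+1)).1 * (v i).2 - (v (j+1)).2 * (v i).1| ≤ M)
    (a : ZMod n → ℤ) (B : ℤ) (hB : B < a j)
    (hmin : ∀ r : ℤ × ℤ, (∀ i, -a i ≤ dotZaux r (v i)) → -B ≤ dotZaux r (v j))
    (p : ℤ × ℤ) (k : ℤ) (hk : 2 * M ≤ k) (hpj : dotZaux p (v j) = -B)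
    (hp : ∀ i, -a i ≤ dotZaux p (v i))
    (hq : ∀ i, -a i ≤ dotZaux (p.1 - k * (v j).2, p.2 + k * (v j).1) (v i)) : False := by
  have hd := hv.2.1 j
  have hM0 : 0 ≤ M := le_trans (abs_nonneg _) (hM j)
  have key := hmin (p.1 - M * (v j).2 - (v (j+1)).2, p.2 + M * (v j).1 + (v (j+1)).1) ?_
  · simp only [dotZaux] at key hpj
    nlinarith
  intro i
  have h1 := hp i
  have h2 := hq i
  have h3 := abs_le.mp (hM i)
  simp only [dotZaux] at h1 h2 hpj ⊢
  rcases lt_trichotomy ((v j).1 * (v i).2 - (v j).2 * (v i).1) 0 with h | h | h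
  · have : (k - M) * ((v j).1 * (v i).2 - (v j).2 * (v i).1 + 1) ≤ 0 :=
      mul_nonpos_of_nonneg_of_nonpos (by linarith) (by omega)
    nlinarith
  · set c := (v i).1 * (v (j+1)).2 - (v i).2 * (v (j+1)).1 with hc
    have e1 : (v i).1 = c * (v j).1 := by
      rw [hc]; linear_combination (-(v i).1) * hd + (v (j+1)).1 * h
    have e2 : (v i).2 = c * (v j).2 := by
      rw [hc]; linear_combination (-(v i).2) * hd + (v (j+1)).2 * h
    rcases le_or_gt c 0 with hc0 | hc0
    · have : M * ((v j).1 * (v i).2 - (v j).2 * (v i).1) = 0 := by rw [h, mul_zero]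
      nlinarith
    · have := fan_inj_aux n v hv i j c hc0 e1 e2
      subst this
      nlinarith
  · have : M * ((v j).1 * (v i).2 - (v j).2 * (v i).1 - 1) ≥ 0 :=
      mul_nonneg (by linarith) (by omega)
    nlinarith

/-- **Lemma (bounded lattice length of the shrunken edges).** There is a
constant `C`, depending only on the fan, such that for every `a` with
`a i ≥ 0`, letting `b i` be the least integer `c` with
`⟨s, v i⟩ ≥ -c` for all lattice points `s` of `P(a)`, and letting
`J = {i : b i < a i}`, the total number of lattice points on the faces
`σ_j(b)` for `j ∈ J` is at most `C`. -/
theorem lemma_length (n : ℕ) (hn : 3 ≤ n) (v : ZMod n → ℤ × ℤ)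
    (hv : IsCompleteSmoothFan n v) :
    ∃ C : ℕ, ∀ a b : ZMod n → ℤ, (∀ i, 0 ≤ a i) →
      (∀ i, IsLeast {c : ℤ |
          ∀ s ∈ Pgon n v a ∩ latticeR2, -(c : ℝ) ≤ dotR s (vecR (v i))} (b i)) →
      (((⋃ j ∈ {i : ZMod n | b i < a i}, face n v b j) ∩ latticeR2)).ncard ≤ C := by
  classical
  have : NeZero n := ⟨by omega⟩
  obtain ⟨M, hM⟩ : ∃ M : ℕ, ∀ j i : ZMod n,
      |(v (j+1)).1 * (v i).2 - (v (j+1)).2 * (v i).1| ≤ (M : ℤ) := by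
    refine ⟨∑ x : ZMod n × ZMod n,
      ((v (x.1+1)).1 * (v x.2).2 - (v (x.1+1)).2 * (v x.2).1).natAbs, fun j i => ?_⟩
    rw [Int.abs_eq_natAbs]
    exact_mod_cast Finset.single_le_sum (f := fun x : ZMod n × ZMod n =>
      ((v (x.1+1)).1 * (v x.2).2 - (v (x.1+1)).2 * (v x.2).1).natAbs)
      (fun _ _ => Nat.zero_le _) (Finset.mem_univ (j, i))
  refine ⟨n * (4 * M + 1), fun a b _ hb => ?_⟩
  have hba : ∀ i, b i ≤ a i := fun i => (hb i).2 (fun s hs => hs.1 i)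
  have hmin : ∀ j, ∀ r : ℤ × ℤ, (∀ i, -a i ≤ dotZaux r (v i)) → -b j ≤ dotZaux r (v j) := by
    intro j r hr
    have := (hb j).1 (vecR r) ⟨fun i => by
      rw [dotR_vecR_aux]; exact_mod_cast hr i, r, rfl⟩
    rw [dotR_vecR_aux] at this
    exact_mod_cast this
  have hface : ∀ j, ∀ m : ℤ × ℤ, vecR m ∈ face n v b j →
      (∀ i, -a i ≤ dotZaux m (v i)) ∧ dotZaux m (v j) = - b j := by
    intro j m hm
    obtain ⟨h1, h2⟩ := hm
    rw [dotR_vecR_aux] at h2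
    refine ⟨fun i => ?_, by exact_mod_cast h2⟩
    have h3 := h1 i
    rw [dotR_vecR_aux] at h3
    have h4 : -b i ≤ dotZaux m (v i) := by exact_mod_cast h3
    linarith [hba i]
  have hF : ∀ j, ∃ F : Finset (ℝ × ℝ), F.card ≤ 4 * M + 1 ∧
      (b j < a j → face n v b j ∩ latticeR2 ⊆ F) := by
    intro j
    by_cases hj : b j < a j ∧ (face n v b j ∩ latticeR2).Nonempty
    · obtain ⟨hj, _, hp, p, rfl⟩ := hj
      obtain ⟨hp1, hp2⟩ := hface j p hp
      refine ⟨(Finset.Icc (-(2 * M : ℤ)) (2 * M)).image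
        (fun k => vecR (p.1 - k * (v j).2, p.2 + k * (v j).1)), ?_, fun _ => ?_⟩
      · refine Finset.card_image_le.trans ?_
        rw [Int.card_Icc]; omega
      · rintro _ ⟨hq, q, rfl⟩
        obtain ⟨hq1, hq2⟩ := hface j q hq
        have hd := hv.2.1 j
        obtain ⟨k, hk⟩ : ∃ k, k = dotZaux q (v (j+1)) - dotZaux p (v (j+1)) := ⟨_, rfl⟩
        have e1 : q.1 = p.1 - k * (v j).2 := by
          simp only [dotZaux] at hk hp2 hq2
          rw [hk]
          linear_combination (p.1 - q.1) * hd + (v (j+1)).2 * (hq2 - hp2)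
        have e2 : q.2 = p.2 + k * (v j).1 := by
          simp only [dotZaux] at hk hp2 hq2
          rw [hk]
          linear_combination (p.2 - q.2) * hd - (v (j+1)).1 * (hq2 - hp2)
        have e3 : q = (p.1 - k * (v j).2, p.2 + k * (v j).1) := Prod.ext e1 e2
        have e4 : p = (q.1 - (-k) * (v j).2, q.2 + (-k) * (v j).1) :=
          Prod.ext (by simp only; linarith) (by simp only; linarith)
        simp only [Finset.coe_image, Set.mem_image, Finset.coe_Icc, Set.mem_Icc]
        refine ⟨k, ⟨?_, ?_⟩, by rw [← e3]⟩
        · by_contra hcon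
          exact core_aux n v hv M j (hM j) a (b j) hj (hmin j) q (-k) (by linarith) hq2 hq1
            (by rw [← e4]; exact hp1)
        · by_contra hcon
          exact core_aux n v hv M j (hM j) a (b j) hj (hmin j) p k (by linarith) hp2 hp1
            (by rw [← e3]; exact hq1)
    · refine ⟨∅, by simp, fun h => ?_⟩
      have : ¬ (face n v b j ∩ latticeR2).Nonempty := fun h' => hj ⟨h, h'⟩
      rw [Set.not_nonempty_iff_eq_empty.mp this]
      simp
  choose F hF1 hF2 using hF
  have hsub : ((⋃ j ∈ {i : ZMod n | b i < a i}, face n v b j) ∩ latticeR2) ⊆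
      ((Finset.univ.biUnion F : Finset (ℝ × ℝ)) : Set (ℝ × ℝ)) := by
    rintro x ⟨hx, hx2⟩
    simp only [Set.mem_iUnion] at hx
    obtain ⟨j, hj, hx⟩ := hx
    simp only [Finset.coe_biUnion, Set.mem_iUnion]
    exact ⟨j, by simp, hF2 j hj ⟨hx, hx2⟩⟩
  refine (Set.ncard_le_ncard hsub (Finset.finite_toSet _)).trans ?_
  rw [Set.ncard_coe_finset]
  refine (Finset.card_biUnion_le_card_mul _ _ _ (fun j _ => hF1 j)).trans ?_
  rw [Finset.card_univ, ZMod.card]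
end

section
/- Proposition (finiteness of the shapes of the trimmed regions up to lattice translation). There exists a finite collection F of compact subsets of ℝ², depending only on v_1, …, v_n, with the following property. For every a ∈ ℤⁿ with a_i ≥ 0 for all i, set S = P(a) ∩ ℤ² and b_i = min{c ∈ ℤ : ⟨s, v_i⟩ ≥ -c for all s ∈ S} for each i. Then the closure of every connected component of P(a) \ P(b) is of the form t + F₀ for some t ∈ ℤ² and some F₀ ∈ F. (That is, even though infinitely many a may give rise to the same P(b), up to translation by lattice vectors only finitely many polygons occur as connected components of P(a) \ P(b).) -/
open scoped Pointwise

namespace TrimAux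

lemma dot_add (u w z : ℝ × ℝ) : dotR (u + w) z = dotR u z + dotR w z := by
  simp [dotR]; ring

lemma dot_smul (c : ℝ) (u z : ℝ × ℝ) : dotR (c • u) z = c * dotR u z := by
  simp [dotR]; ring

/-- The piece cut off by the `i`th inequality. -/
def Cut (n : ℕ) (v : ZMod n → ℤ × ℤ) (a b : ZMod n → ℤ) (i : ZMod n) : Set (ℝ × ℝ) :=
  {u | (∀ j, -(a j : ℝ) ≤ dotR u (vecR (v j))) ∧ dotR u (vecR (v i)) < -(b i : ℝ)}

lemma cut_convex (n : ℕ) (v : ZMod n → ℤ × ℤ) (a b : ZMod n → ℤ) (i : ZMod n) :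
    Convex ℝ (Cut n v a b i) := by
  intro x hx y hy s t hs ht hst
  refine ⟨fun j => ?_, ?_⟩
  · rw [dot_add, dot_smul, dot_smul]
    have h1 := mul_le_mul_of_nonneg_left (hx.1 j) hs
    have h2 := mul_le_mul_of_nonneg_left (hy.1 j) ht
    have : -(a j : ℝ) = s * -(a j : ℝ) + t * -(a j : ℝ) := by rw [← add_mul, hst, one_mul]
    linarith
  · rw [dot_add, dot_smul, dot_smul]
    exact (convex_Iio (-(b i : ℝ))) hx.2 hy.2 hs ht hst

lemma pgon_sdiff_eq (n : ℕ) (v : ZMod n → ℤ × ℤ) (a b : ZMod n → ℤ) :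
    Pgon n v a \ Pgon n v b = ⋃ i, Cut n v a b i := by
  ext u
  simp only [Pgon, Cut, Set.mem_sdiff, Set.mem_ofPred_eq, Set.mem_iUnion, not_forall, not_le]
  constructor
  · rintro ⟨h, i, hi⟩; exact ⟨i, h, hi⟩
  · rintro ⟨i, h, hi⟩; exact ⟨h, i, hi⟩

/-- Some inequality decreases in every direction. -/
lemma exists_neg (n : ℕ) (v : ZMod n → ℤ × ℤ) (hv : IsCompleteSmoothFan n v)
    (d : ℝ × ℝ) (hd : d ≠ 0) : ∃ j, dotR d (vecR (v j)) < 0 := by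
  obtain ⟨i, ⟨s, t, hs, ht, h⟩, -⟩ := hv.2.2 (-d) (neg_ne_zero.2 hd)
  by_contra! hc
  have h1 := hc i
  have h2 := hc (i + 1)
  have e1 : -d.1 = s * (vecR (v i)).1 + t * (vecR (v (i+1))).1 := by
    simpa using congrArg Prod.fst h
  have e2 : -d.2 = s * (vecR (v i)).2 + t * (vecR (v (i+1))).2 := by
    simpa using congrArg Prod.snd h
  have e3 : -(d.1 ^ 2 + d.2 ^ 2) = s * dotR d (vecR (v i)) + t * dotR d (vecR (v (i+1))) := by
    simp only [dotR]; linear_combination d.1 * e1 + d.2 * e2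
  have h3 := mul_nonneg hs h1
  have h4 := mul_nonneg ht.le h2
  apply hd
  have h5 : d.1 ^ 2 = 0 := by nlinarith [sq_nonneg d.1, sq_nonneg d.2]
  have h6 : d.2 ^ 2 = 0 := by nlinarith [sq_nonneg d.1, sq_nonneg d.2]
  exact Prod.ext (by simpa using h5) (by simpa using h6)

/-- Exit point of a ray. -/
lemma exists_exit (n : ℕ) [NeZero n] (v : ZMod n → ℤ × ℤ) (hv : IsCompleteSmoothFan n v)
    (a : ZMod n → ℤ) (d : ℝ × ℝ) (hd : d ≠ 0) (z : ℝ × ℝ)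
    (hz : ∀ j, -(a j : ℝ) ≤ dotR z (vecR (v j))) :
    ∃ t : ℝ, 0 ≤ t ∧ ∃ j, (∀ j, -(a j : ℝ) ≤ dotR (z + t • d) (vecR (v j))) ∧
      dotR (z + t • d) (vecR (v j)) = -(a j : ℝ) := by
  classical
  let s : Finset (ZMod n) := Finset.univ.filter (fun j => dotR d (vecR (v j)) < 0)
  have hs : s.Nonempty := by
    obtain ⟨j, hj⟩ := exists_neg n v hv d hd
    exact ⟨j, by simpa [s] using hj⟩
  let f : ZMod n → ℝ := fun j => (dotR z (vecR (v j)) + a j) / (-dotR d (vecR (v j)))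
  obtain ⟨j, hj, hmin⟩ := s.exists_min_image f hs
  have hj' : dotR d (vecR (v j)) < 0 := by simpa [s] using hj
  have hf0 : 0 ≤ f j := div_nonneg (by linarith [hz j]) (by linarith)
  refine ⟨f j, hf0, j, fun k => ?_, ?_⟩
  · rw [dot_add, dot_smul]
    by_cases hk : dotR d (vecR (v k)) < 0
    · have h1 := hmin k (by simpa [s] using hk)
      have h2 : f k * (-dotR d (vecR (v k))) = dotR z (vecR (v k)) + a k :=
        div_mul_cancel₀ _ (by linarith)
      have h3 := mul_le_mul_of_nonneg_right h1 (by linarith : 0 ≤ -dotR d (vecR (v k)))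
      linarith
    · have := mul_nonneg hf0 (not_lt.1 hk)
      linarith [hz k]
  · rw [dot_add, dot_smul]
    have h2 : f j * (-dotR d (vecR (v j))) = dotR z (vecR (v j)) + a j :=
      div_mul_cancel₀ _ (by linarith)
    linarith

/-- A long lattice segment contains a lattice point. -/
lemma lattice_on_segment (p : ℤ × ℤ) (hp : IsCoprime p.1 p.2) (c : ℤ) (e f : ℝ × ℝ)
    (he : dotR e (vecR p) = -(c : ℝ)) (hf : dotR f (vecR p) = -(c : ℝ)) :
    ∃ l : ℝ, f = e + l • ((-(p.2 : ℝ), (p.1 : ℝ)) : ℝ × ℝ) ∧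
      (1 ≤ |l| → ∃ m : ℤ × ℤ, vecR m ∈ segment ℝ e f) := by
  obtain ⟨r, s, hrs⟩ := hp
  have hrs' : (r : ℝ) * p.1 + s * p.2 = 1 := by exact_mod_cast hrs
  -- parameter of a point on the line
  let g : ℝ × ℝ → ℝ := fun x => -(s : ℝ) * x.1 + r * x.2
  have key : ∀ x : ℝ × ℝ, dotR x (vecR p) = -(c : ℝ) →
      x = (-(c : ℝ) * r - g x * p.2, -(c : ℝ) * s + g x * p.1) := by
    intro x hx
    simp only [dotR, vecR] at hx
    ext
    · simp only [g]; rw [← hx]; linear_combination (-x.1) * hrs'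
    · simp only [g]; rw [← hx]; linear_combination (-x.2) * hrs'
  have ke := key e he
  have kf := key f hf
  generalize g e = α at ke
  generalize g f = β at kf
  clear key he hf g
  subst ke kf
  refine ⟨β - α, ?_, ?_⟩
  · ext
    · simp; ring
    · simp; ring
  · intro hl
    have : ∃ m : ℤ, (m : ℝ) ∈ segment ℝ (α) (β) := by
      rw [segment_eq_uIcc]
      rcases le_total (α) (β) with h | h
      · rw [abs_of_nonneg (by linarith)] at hl
        refine ⟨⌊β⌋, ?_⟩
        rw [Set.uIcc_of_le h]
        exact ⟨by linarith [Int.lt_floor_add_one (β)], Int.floor_le _⟩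
      · rw [abs_of_nonpos (by linarith)] at hl
        refine ⟨⌊α⌋, ?_⟩
        rw [Set.uIcc_of_ge h]
        exact ⟨by linarith [Int.lt_floor_add_one (α)], Int.floor_le _⟩
    obtain ⟨m, A, B, hA, hB, hAB, hm⟩ := this
    refine ⟨(-c * r - m * p.2, -c * s + m * p.1), A, B, hA, hB, hAB, ?_⟩
    simp only [smul_eq_mul] at hm
    ext
    · simp [vecR, ← hm]
      linear_combination (-(c : ℝ) * r) * hAB
    · simp [vecR, ← hm]
      linear_combination (-(c : ℝ) * s) * hAB

/-- Size of the fan. -/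
noncomputable def W (n : ℕ) [NeZero n] (v : ZMod n → ℤ × ℤ) : ℝ :=
  ∑ j, (|((v j).1 : ℝ)| + |((v j).2 : ℝ)|)

lemma W_ge (n : ℕ) [NeZero n] (v : ZMod n → ℤ × ℤ) (j : ZMod n) :
    |((v j).1 : ℝ)| + |((v j).2 : ℝ)| ≤ W n v :=
  Finset.single_le_sum (f := fun j => |((v j).1 : ℝ)| + |((v j).2 : ℝ)|)
    (fun i _ => by positivity) (Finset.mem_univ j)

lemma W_nonneg (n : ℕ) [NeZero n] (v : ZMod n → ℤ × ℤ) : 0 ≤ W n v :=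
  Finset.sum_nonneg (fun i _ => by positivity)

lemma cut_diam (n : ℕ) [NeZero n] (v : ZMod n → ℤ × ℤ) (hv : IsCompleteSmoothFan n v)
    (a b : ZMod n → ℤ) (i : ZMod n) (hfree : ∀ m : ℤ × ℤ, vecR m ∉ Cut n v a b i)
    (u w : ℝ × ℝ) (hu : u ∈ Cut n v a b i) (hw : w ∈ Cut n v a b i) :
    dist u w ≤ n * W n v := by
  have hW := W_nonneg n v
  have hn0 : (0 : ℝ) < n := by exact_mod_cast Nat.pos_of_ne_zero (NeZero.ne n)
  by_cases huw : u = w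
  · subst huw; rw [dist_self]; positivity
  obtain ⟨d, hd0, hdp, hdi⟩ : ∃ d : ℝ × ℝ, d ≠ 0 ∧ dotR (w - u) d = 0 ∧
      dotR d (vecR (v i)) ≤ 0 := by
    have hne : w - u ≠ 0 := sub_ne_zero.2 (Ne.symm huw)
    let d0 : ℝ × ℝ := (-(w - u).2, (w - u).1)
    have h0 : d0 ≠ 0 := by
      intro h
      apply hne
      have h1 := congrArg Prod.fst h
      have h2 := congrArg Prod.snd h
      simp only [d0, Prod.fst_zero, Prod.snd_zero, neg_eq_zero] at h1 h2
      exact Prod.ext h2 h1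
    rcases le_total (dotR d0 (vecR (v i))) 0 with h | h
    · exact ⟨d0, h0, by simp [dotR, d0]; ring, h⟩
    · refine ⟨-d0, neg_ne_zero.2 h0, by simp [dotR, d0]; ring, ?_⟩
      have : dotR (-d0) (vecR (v i)) = - dotR d0 (vecR (v i)) := by simp [dotR]; ring
      linarith
  let z : ℕ → ℝ × ℝ := fun k => u + ((k : ℝ) / n) • (w - u)
  have hz : ∀ k : Fin (n + 1), z k ∈ Cut n v a b i := by
    intro k
    have hk : (k : ℝ) ≤ n := by exact_mod_cast Nat.lt_succ_iff.1 k.2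
    exact (cut_convex n v a b i).add_smul_sub_mem hu hw
      ⟨by positivity, by rw [div_le_one hn0]; exact hk⟩
  choose t ht j hjP hjt using fun k : Fin (n + 1) =>
    exists_exit n v hv a d hd0 (z k) (hz k).1
  have hmem : ∀ k : Fin (n + 1), z k + t k • d ∈ Cut n v a b i := by
    intro k
    refine ⟨hjP k, ?_⟩
    rw [dot_add, dot_smul]
    have := mul_nonpos_of_nonneg_of_nonpos (ht k) hdi
    linarith [(hz k).2]
  obtain ⟨k, k', hkk, hjj⟩ := Fintype.exists_ne_map_eq_of_card_lt j (by simp [ZMod.card])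
  have hk' := hjt k'
  rw [← hjj] at hk'
  obtain ⟨l, hl, hl2⟩ := lattice_on_segment (v (j k)) (hv.1 _) (a (j k)) _ _ (hjt k) hk'
  have hl1 : |l| < 1 := by
    by_contra! h
    obtain ⟨m, hm⟩ := hl2 h
    exact hfree m ((cut_convex n v a b i).segment_subset (hmem k) (hmem k') hm)
  have hq := W_ge n v (j k)
  set q1 : ℝ := ((v (j k)).1 : ℝ)
  set q2 : ℝ := ((v (j k)).2 : ℝ)
  have e1 := congrArg Prod.fst hl
  have e2 := congrArg Prod.snd hl
  simp only [z, Prod.fst_add, Prod.snd_add, Prod.smul_fst, Prod.smul_snd, smul_eq_mul,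
    Prod.fst_sub, Prod.snd_sub] at e1 e2
  simp only [dotR, Prod.fst_sub, Prod.snd_sub] at hdp
  set x := w.1 - u.1
  set y := w.2 - u.2
  have hmain : (((k' : ℕ) : ℝ) - ((k : ℕ) : ℝ)) * (x ^ 2 + y ^ 2) = n * (l * (x * (-q2) + y * q1)) := by
    have e3 : (((k' : ℕ) : ℝ) / n - ((k : ℕ) : ℝ) / n) * (x ^ 2 + y ^ 2) = l * (x * (-q2) + y * q1) := by
      linear_combination x * e1 + y * e2 + (t k - t k') * hdp
    rw [← e3]; field_simp
  have hint : 1 ≤ |((k' : ℕ) : ℝ) - ((k : ℕ) : ℝ)| := by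
    have : ((k' : ℕ) : ℤ) - ((k : ℕ) : ℤ) ≠ 0 := by
      intro h; apply hkk; apply Fin.ext; omega
    exact_mod_cast Int.one_le_abs this
  set N := x ^ 2 + y ^ 2
  have hN : 0 ≤ N := by positivity
  have h1 : N ≤ n * |x * (-q2) + y * q1| := by
    have h := congrArg abs hmain
    rw [abs_mul, abs_mul, abs_mul, abs_of_nonneg hN, abs_of_pos hn0] at h
    have ha : N ≤ |((k' : ℕ) : ℝ) - ((k : ℕ) : ℝ)| * N := le_mul_of_one_le_left hN hint
    have hb : |l| * |x * (-q2) + y * q1| ≤ |x * (-q2) + y * q1| :=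
      mul_le_of_le_one_left (abs_nonneg _) hl1.le
    have hc := mul_le_mul_of_nonneg_left hb hn0.le
    linarith
  have h2 : (x * (-q2) + y * q1) ^ 2 ≤ N * (W n v) ^ 2 := by
    have h3 : (x * (-q2) + y * q1) ^ 2 ≤ N * (q1 ^ 2 + q2 ^ 2) := by
      linear_combination sq_nonneg (x * q1 + y * q2)
    have h4 : q1 ^ 2 + q2 ^ 2 ≤ (W n v) ^ 2 := by
      have := pow_le_pow_left₀ (by positivity) hq 2
      linear_combination this + 2 * mul_nonneg (abs_nonneg q1) (abs_nonneg q2) - sq_abs q1 - sq_abs q2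
    exact h3.trans (mul_le_mul_of_nonneg_left h4 hN)
  have h5 : N ≤ (n * W n v) ^ 2 := by
    have h6 : N ^ 2 ≤ n ^ 2 * (N * (W n v) ^ 2) := by
      have := pow_le_pow_left₀ hN h1 2
      rw [mul_pow, sq_abs] at this
      exact this.trans (mul_le_mul_of_nonneg_left h2 (by positivity))
    rcases hN.eq_or_lt with h | h
    · rw [← h]; positivity
    · have : N * N ≤ N * (n * W n v) ^ 2 := by linear_combination h6
      exact le_of_mul_le_mul_left this h
  rw [Prod.dist_eq, dist_comm u.1, dist_comm u.2, Real.dist_eq, Real.dist_eq]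
  have hnW : 0 ≤ n * W n v := by positivity
  refine max_le (abs_le_of_sq_le_sq ?_ hnW) (abs_le_of_sq_le_sq ?_ hnW)
  · exact le_trans (le_add_of_nonneg_right (sq_nonneg y)) h5
  · exact le_trans (le_add_of_nonneg_left (sq_nonneg x)) h5

/-- A preconnected set covered by `n` sets of diameter at most `D` is bounded. -/
lemma preconn_bound {ι : Type*} [Fintype ι] (K : Set (ℝ × ℝ)) (hK : IsPreconnected K)
    (C : ι → Set (ℝ × ℝ)) (hC : K ⊆ ⋃ i, C i) (D : ℝ) (hD0 : 0 ≤ D)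
    (hD : ∀ i, ∀ u ∈ C i, ∀ w ∈ C i, dist u w ≤ D) (x : ℝ × ℝ) (hx : x ∈ K)
    (y : ℝ × ℝ) (hy : y ∈ K) : dist y x ≤ Fintype.card ι * (D + 1) := by
  by_contra! hlt
  have him : IsPreconnected ((fun z => dist z x) '' K) :=
    hK.image _ (by fun_prop)
  have hsub : Set.Icc (0 : ℝ) (dist y x) ⊆ (fun z => dist z x) '' K :=
    him.Icc_subset ⟨x, hx, dist_self x⟩ ⟨y, hy, rfl⟩
  have : ∀ k : Fin (Fintype.card ι + 1), ∃ z ∈ K, dist z x = k * (D + 1) := by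
    intro k
    have hk : ((k : ℕ) : ℝ) ≤ Fintype.card ι := by exact_mod_cast Nat.lt_succ_iff.1 k.2
    have := hsub (a := k * (D + 1)) ⟨by positivity,
      (mul_le_mul_of_nonneg_right hk (by linarith)).trans hlt.le⟩
    simpa using this
  choose z hzK hz using this
  choose i hi using fun k => Set.mem_iUnion.1 (hC (hzK k))
  obtain ⟨k, k', hkk, hii⟩ := Fintype.exists_ne_map_eq_of_card_lt i (by simp)
  have h1 := hD (i k) (z k) (hi k) (z k') (hii ▸ hi k')
  have h2 := abs_dist_sub_le (z k) (z k') x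
  rw [hz, hz, ← sub_mul, abs_mul, abs_of_nonneg (by linarith : 0 ≤ D + 1)] at h2
  have hint : 1 ≤ |((k : ℕ) : ℝ) - ((k' : ℕ) : ℝ)| := by
    have : ((k : ℕ) : ℤ) - ((k' : ℕ) : ℤ) ≠ 0 := by
      intro h; apply hkk; apply Fin.ext; omega
    exact_mod_cast Int.one_le_abs this
  nlinarith

/-- Clamping to `[-M, M]`. -/
def clamp (M c : ℤ) : ℤ := max (-M) (min M c)

lemma clamp_le (M c : ℤ) (x : ℝ) (hx : |x| < M) :
    -(clamp M c : ℝ) ≤ x ↔ -(c : ℝ) ≤ x := by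
  obtain ⟨h1, h2⟩ := abs_lt.1 hx
  have hM : (0 : ℝ) < M := lt_of_le_of_lt (abs_nonneg x) hx
  have hM' : 0 < M := by exact_mod_cast hM
  unfold clamp
  rcases le_total M c with h | h
  · rw [min_eq_left h, max_eq_right (by omega)]
    have : (M : ℝ) ≤ c := by exact_mod_cast h
    constructor <;> intro <;> linarith
  · rw [min_eq_right h]
    rcases le_total (-M) c with h' | h'
    · rw [max_eq_right h']
    · rw [max_eq_left h']
      have : (c : ℝ) ≤ -M := by exact_mod_cast h'
      push_cast
      constructor <;> intro <;> linarith

lemma clamp_mem (M c : ℤ) (hM : 0 ≤ M) : clamp M c ∈ Set.Icc (-M) M := by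
  unfold clamp
  exact ⟨le_max_left _ _, max_le (by omega) (min_le_left _ _)⟩

/-- Model pieces. -/
def Model (n : ℕ) (v : ZMod n → ℤ × ℤ) (R : ℝ) (I : Set (ZMod n)) (a b : ZMod n → ℤ) :
    Set (ℝ × ℝ) :=
  Metric.closedBall 0 R ∩ ⋃ i ∈ I, Cut n v a b i

lemma component_eq (n : ℕ) (v : ZMod n → ℤ × ℤ) (a b : ZMod n → ℤ) (x : ℝ × ℝ) :
    ∃ I : Set (ZMod n), connectedComponentIn (Pgon n v a \ Pgon n v b) x =
      ⋃ i ∈ I, Cut n v a b i := by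
  set K := connectedComponentIn (Pgon n v a \ Pgon n v b) x with hK
  refine ⟨{i | (Cut n v a b i ∩ K).Nonempty}, ?_⟩
  ext y
  simp only [Set.mem_iUnion, Set.mem_ofPred_eq, exists_prop]
  constructor
  · intro hy
    have := connectedComponentIn_subset _ _ hy
    rw [pgon_sdiff_eq, Set.mem_iUnion] at this
    obtain ⟨i, hi⟩ := this
    exact ⟨i, ⟨y, hi, hy⟩, hi⟩
  · rintro ⟨i, ⟨z, hz, hzK⟩, hy⟩
    rw [hK, connectedComponentIn_eq hzK]
    refine (cut_convex n v a b i).isPreconnected.subset_connectedComponentIn hz ?_ hy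
    rw [pgon_sdiff_eq]
    exact Set.subset_iUnion _ i

end TrimAux

open TrimAux in
/-- **Proposition (finiteness of trimmed regions up to lattice translation).**
There is a finite collection `F` of compact subsets of `ℝ²`, depending only on
the fan, such that for every `a` with `a i ≥ 0`, letting `b i` be the least
integer `c` with `⟨s, v i⟩ ≥ -c` for all lattice points `s` of `P(a)`, the
closure of every connected component of `P(a) \ P(b)` is a lattice translate
of a member of `F`. -/
theorem prop_finitely_many_components (n : ℕ) (hn : 3 ≤ n)
    (v : ZMod n → ℤ × ℤ) (hv : IsCompleteSmoothFan n v) :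
    ∃ F : Set (Set (ℝ × ℝ)), F.Finite ∧ (∀ F₀ ∈ F, IsCompact F₀) ∧
      ∀ a b : ZMod n → ℤ, (∀ i, 0 ≤ a i) →
      (∀ i, IsLeast {c : ℤ |
          ∀ s ∈ Pgon n v a ∩ latticeR2, -(c : ℝ) ≤ dotR s (vecR (v i))} (b i)) →
      ∀ x ∈ Pgon n v a \ Pgon n v b,
        ∃ t : ℤ × ℤ, ∃ F₀ ∈ F,
          closure (connectedComponentIn (Pgon n v a \ Pgon n v b) x) =
            {vecR t} + F₀ := by
  have : NeZero n := ⟨by omega⟩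
  have hW := W_nonneg n v
  set D : ℝ := n * W n v with hD
  have hD0 : 0 ≤ D := by positivity
  set R : ℝ := n * (D + 1) + 1 with hR
  have hR0 : 0 ≤ R := by positivity
  set M : ℤ := ⌈R * W n v⌉ + 1 with hM
  have hMR : R * W n v < M := by
    rw [hM]; push_cast; linarith [Int.le_ceil (R * W n v)]
  have hM0 : 0 ≤ M := by
    have : (0 : ℝ) ≤ M := by nlinarith [mul_nonneg hR0 hW]
    exact_mod_cast this
  have hdot : ∀ u ∈ Metric.closedBall (0 : ℝ × ℝ) R, ∀ j, |dotR u (vecR (v j))| < M := by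
    intro u hu j
    have hu' : ‖u‖ ≤ R := by simpa using hu
    have h1 : |u.1| ≤ R := (norm_fst_le u).trans hu'
    have h2 : |u.2| ≤ R := (norm_snd_le u).trans hu'
    refine lt_of_le_of_lt ?_ hMR
    calc |dotR u (vecR (v j))| ≤ |u.1| * |((v j).1 : ℝ)| + |u.2| * |((v j).2 : ℝ)| := by
          rw [← abs_mul, ← abs_mul]; exact abs_add_le _ _
      _ ≤ R * |((v j).1 : ℝ)| + R * |((v j).2 : ℝ)| := by gcongr
      _ = R * (|((v j).1 : ℝ)| + |((v j).2 : ℝ)|) := by ring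
      _ ≤ R * W n v := mul_le_mul_of_nonneg_left (W_ge n v j) hR0
  let Bx : Set (ZMod n → ℤ) := Set.univ.pi fun _ => Set.Icc (-M) M
  have hBx : Bx.Finite := Set.Finite.pi fun _ => Set.finite_Icc _ _
  refine ⟨(fun p : Set (ZMod n) × (ZMod n → ℤ) × (ZMod n → ℤ) =>
    closure (Model n v R p.1 p.2.1 p.2.2)) '' (Set.univ ×ˢ (Bx ×ˢ Bx)),
    (Set.finite_univ.prod (hBx.prod hBx)).image _, ?_, ?_⟩
  · rintro _ ⟨p, -, rfl⟩
    exact (Metric.isBounded_closedBall.subset Set.inter_subset_left).isCompact_closure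
  intro a b _ hb x hx
  obtain ⟨I, hI⟩ := component_eq n v a b x
  have hfree : ∀ i, ∀ m : ℤ × ℤ, vecR m ∉ Cut n v a b i := by
    intro i m hm
    have := (hb i).1 (vecR m) ⟨hm.1, m, rfl⟩
    linarith [hm.2]
  have hbound : ∀ y ∈ connectedComponentIn (Pgon n v a \ Pgon n v b) x,
      dist y x ≤ n * (D + 1) := by
    intro y hy
    have := preconn_bound _ isPreconnected_connectedComponentIn (Cut n v a b)
      (by rw [← pgon_sdiff_eq]; exact connectedComponentIn_subset _ _) D hD0
      (fun i u hu w hw => cut_diam n v hv a b i (hfree i) u w hu hw) x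
      (mem_connectedComponentIn hx) y hy
    simpa [ZMod.card] using this
  let t : ℤ × ℤ := (⌊x.1⌋, ⌊x.2⌋)
  have hxt : dist x (vecR t) ≤ 1 := by
    rw [Prod.dist_eq, Real.dist_eq, Real.dist_eq]
    simp only [vecR, t]
    refine max_le ?_ ?_ <;> rw [abs_le] <;> constructor <;>
      linarith [Int.floor_le x.1, Int.lt_floor_add_one x.1, Int.floor_le x.2,
        Int.lt_floor_add_one x.2]
  let sh : ZMod n → ℤ := fun j => t.1 * (v j).1 + t.2 * (v j).2
  let a' : ZMod n → ℤ := fun j => clamp M (a j + sh j)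
  let b' : ZMod n → ℤ := fun j => clamp M (b j + sh j)
  refine ⟨t, closure (Model n v R I a' b'), ⟨(I, a', b'), ⟨trivial, ?_, ?_⟩, rfl⟩, ?_⟩
  · exact fun j _ => clamp_mem _ _ hM0
  · exact fun j _ => clamp_mem _ _ hM0
  have hsh : ∀ (u : ℝ × ℝ) j, dotR (vecR t + u) (vecR (v j)) = sh j + dotR u (vecR (v j)) := by
    intro u j
    rw [dot_add]; simp [dotR, vecR, sh]
  have hcut : ∀ u ∈ Metric.closedBall (0 : ℝ × ℝ) R, ∀ i,
      (u ∈ Cut n v a' b' i ↔ vecR t + u ∈ Cut n v a b i) := by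
    intro u hu i
    have hA : ∀ (c : ℤ) j, -((clamp M (c + sh j) : ℤ) : ℝ) ≤ dotR u (vecR (v j)) ↔
        -(c : ℝ) ≤ dotR (vecR t + u) (vecR (v j)) := by
      intro c j
      rw [clamp_le M _ _ (hdot u hu j), hsh]
      push_cast
      constructor <;> intro <;> linarith
    simp only [Cut, Set.mem_ofPred_eq, a', b', hA]
    rw [← not_le, hA, not_le]
  have hKeq : connectedComponentIn (Pgon n v a \ Pgon n v b) x =
      (fun u => vecR t + u) '' Model n v R I a' b' := by
    ext y
    constructor
    · intro hy
      have hyb : y - vecR t ∈ Metric.closedBall (0 : ℝ × ℝ) R := by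
        have h1 := hbound y hy
        have h2 := dist_triangle y x (vecR t)
        rw [mem_closedBall_zero_iff, ← dist_eq_norm]
        linarith
      refine ⟨y - vecR t, ⟨hyb, ?_⟩, by simp⟩
      rw [hI] at hy
      simp only [Set.mem_iUnion, exists_prop] at hy ⊢
      obtain ⟨i, hi, hyi⟩ := hy
      exact ⟨i, hi, (hcut _ hyb i).2 (by simpa using hyi)⟩
    · rintro ⟨u, ⟨hu, hu2⟩, rfl⟩
      rw [hI]
      simp only [Set.mem_iUnion, exists_prop] at hu2 ⊢
      obtain ⟨i, hi, hyi⟩ := hu2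
      exact ⟨i, hi, (hcut _ hu i).1 hyi⟩
  rw [hKeq, Set.singleton_add]
  exact ((Homeomorph.addLeft (vecR t)).image_closure _).symm
end

section
/- Lemma (extreme points of fibers of the sum map). Let A and B be compact convex subsets of ℝ², let p ∈ A + B, and let Q = {(x, y) ∈ A × B : x + y = p}. Let Q₂ be the image of Q under the second projection. If (q₁, q₂) ∈ Q is such that q₂ is an extreme point of Q₂ and q₂ lies in the topological interior of B, then q₁ is an extreme point of A. -/
open scoped Pointwise

/-- **Lemma (extreme points of fibers of the sum map).** Let `A`, `B` be
compact convex subsets of `ℝ²`, let `p ∈ A + B`, and let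
`Q = {(x, y) ∈ A × B : x + y = p}` with `Q₂` its image under the second
projection.  If `(q₁, q₂) ∈ Q`, `q₂` is an extreme point of `Q₂`, and `q₂`
lies in the interior of `B`, then `q₁` is an extreme point of `A`. -/
theorem lemma_fiber_extreme_point (A B : Set (ℝ × ℝ))
    (hAc : IsCompact A) (hAconv : Convex ℝ A)
    (hBc : IsCompact B) (hBconv : Convex ℝ B)
    (p : ℝ × ℝ) (hp : p ∈ A + B)
    (Q : Set ((ℝ × ℝ) × (ℝ × ℝ)))
    (hQ : Q = {z | z.1 ∈ A ∧ z.2 ∈ B ∧ z.1 + z.2 = p})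
    (q₁ q₂ : ℝ × ℝ) (hq : (q₁, q₂) ∈ Q)
    (hext : q₂ ∈ Set.extremePoints ℝ (Prod.snd '' Q))
    (hint : q₂ ∈ interior B) :
    q₁ ∈ Set.extremePoints ℝ A := by
  subst hQ
  obtain ⟨hA, hB, hs⟩ := hq
  simp only at hA hB hs
  refine ⟨hA, ?_⟩
  rintro x hx y hy ⟨a, b, ha, hb, hab, hxy⟩
  have key : ∀ v : ℝ × ℝ, ∀ᶠ t : ℝ in nhdsWithin 0 (Set.Ioi 0), q₂ - t • (v - q₁) ∈ B := by
    intro v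
    have hc : Filter.Tendsto (fun t : ℝ => q₂ - t • (v - q₁)) (nhds 0) (nhds q₂) := by
      have h : Continuous (fun t : ℝ => q₂ - t • (v - q₁)) := by fun_prop
      simpa using h.tendsto 0
    exact (hc.eventually (mem_interior_iff_mem_nhds.1 hint)).filter_mono nhdsWithin_le_nhds
  have h1 : ∀ᶠ t : ℝ in nhdsWithin 0 (Set.Ioi 0), t ∈ Set.Ioo (0 : ℝ) 1 :=
    Ioo_mem_nhdsGT one_pos
  obtain ⟨t, ⟨hxB, hyB⟩, ht0, ht1⟩ := (((key x).and (key y)).and h1).exists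
  have mem : ∀ v ∈ A, q₂ - t • (v - q₁) ∈ B →
      q₂ - t • (v - q₁) ∈ Prod.snd '' {z : (ℝ × ℝ) × (ℝ × ℝ) | z.1 ∈ A ∧ z.2 ∈ B ∧ z.1 + z.2 = p} := by
    intro v hv hvB
    refine ⟨(q₁ + t • (v - q₁), q₂ - t • (v - q₁)), ⟨?_, hvB, ?_⟩, rfl⟩
    · exact hAconv.add_smul_sub_mem hA hv ⟨ht0.le, ht1.le⟩
    · rw [← hs]
      simp only
      abel
  have hseg : q₂ ∈ openSegment ℝ (q₂ - t • (x - q₁)) (q₂ - t • (y - q₁)) := by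
    refine ⟨a, b, ha, hb, hab, ?_⟩
    have e : a • (q₂ - t • (x - q₁)) + b • (q₂ - t • (y - q₁))
        = (a + b) • q₂ - t • ((a • x + b • y) - (a + b) • q₁) := by module
    rw [e, hab, hxy]
    simp
  have h := hext.2 (mem x hx hxB) (mem y hy hyB) hseg
  have h0 : t • (x - q₁) = 0 := by simpa using h
  rcases smul_eq_zero.1 h0 with h | h
  · exact absurd h ht0.ne'
  · exact sub_eq_zero.1 h
end
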